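/- arXiv:2406.06480 — 2 statements merged into one kernel-verified Lean document; each statement's English description precedes it below -/
import Mathlib

section
/- Let Γ be an irreducible labelled graph that is not a clique, i.e., there exist distinct vertices u, v with m(u,v) = ∞. Then no nontrivial positive element of the Artin group A_Γ is central; that is, no nontrivial central element of A_Γ admits a positive spelling. -/
/-- A labelled graph: a vertex set `V` and a symmetric labelling `m : V → V → ℕ∞`
with `m u v ≥ 2` for `u ≠ v` (`m u v = ∞` means no edge). -/
structure LabelledGraph (V : Type*) where
  m : V → V → ℕ∞
  symm : ∀ u v, m u v = m v u
  two_le : ∀ u v, u ≠ v → 2 ≤ m u v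

namespace LabelledGraph

variable {V W : Type*}

/-- The alternating product `x * y * x * ⋯` with `n` terms. -/
def altProd {G : Type*} [Monoid G] (x y : G) : ℕ → G
  | 0 => 1
  | n + 1 => x * altProd y x n

/-- The alternating word `u v u v ⋯` with `n` terms in the free group. -/
def altWord (u v : V) (n : ℕ) : FreeGroup V :=
  altProd (FreeGroup.of u) (FreeGroup.of v) n

/-- The Artin relations of a labelled graph: for each `u ≠ v` with finite label
`m u v = k`, the relation `(u v u ⋯) = (v u v ⋯)` (both sides with `k` terms). -/
def artinRels (Γ : LabelledGraph V) : Set (FreeGroup V) :=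
  { r | ∃ (u v : V) (k : ℕ), u ≠ v ∧ Γ.m u v = (k : ℕ∞) ∧
        r = altWord u v k * (altWord v u k)⁻¹ }

/-- The Artin group of a labelled graph. -/
abbrev ArtinGroup (Γ : LabelledGraph V) : Type _ := PresentedGroup Γ.artinRels

/-- The standard generators of an Artin group. -/
def σ (Γ : LabelledGraph V) (v : V) : Γ.ArtinGroup := PresentedGroup.of v

/-- The special subgroup of the Artin group generated by `{σ v : v ∈ K}`. -/
def specialSubgroup (Γ : LabelledGraph V) (K : Set V) : Subgroup Γ.ArtinGroup :=
  Subgroup.closure (Γ.σ '' K)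

/-- A cone point of `Γ`: a vertex `t` with `m t v < ∞` for every `v ≠ t`. -/
def IsConePoint (Γ : LabelledGraph V) (t : V) : Prop :=
  ∀ v : V, v ≠ t → Γ.m t v ≠ ⊤

/-- The induced labelled subgraph on a subset `K` of the vertices. -/
def induce (Γ : LabelledGraph V) (K : Set V) : LabelledGraph K where
  m u v := Γ.m u v
  symm u v := Γ.symm u v
  two_le u v h := Γ.two_le u v (fun e => h (Subtype.ext e))

/-- `Γ` is irreducible if its vertex set admits no partition into two nonempty sets
with all labels between the two parts equal to `2`. -/
def Irreducible (Γ : LabelledGraph V) : Prop :=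
  ¬ ∃ V₁ V₂ : Set V, V₁.Nonempty ∧ V₂.Nonempty ∧ Disjoint V₁ V₂ ∧ V₁ ∪ V₂ = Set.univ ∧
      ∀ u ∈ V₁, ∀ v ∈ V₂, Γ.m u v = 2

/-- The square relations `σ_v² = 1` defining the Coxeter quotient. -/
def squareRels (V : Type*) : Set (FreeGroup V) :=
  Set.range fun v : V => FreeGroup.of v * FreeGroup.of v

/-- The Coxeter group of a labelled graph: the quotient of the Artin group obtained
by adding the relations `σ_v² = 1`. -/
abbrev CoxeterGroupOf (Γ : LabelledGraph V) : Type _ :=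
  PresentedGroup (Γ.artinRels ∪ squareRels V)

/-- `Γ` is spherical if its Coxeter group is finite. -/
def Spherical (Γ : LabelledGraph V) : Prop := Finite Γ.CoxeterGroupOf

/-- The natural surjection `θ` from the Artin group to the Coxeter group. -/
def artinToCoxeter (Γ : LabelledGraph V) : Γ.ArtinGroup →* Γ.CoxeterGroupOf :=
  QuotientGroup.map _ _ (MonoidHom.id _)
    (by
      intro x hx
      simpa using Subgroup.normalClosure_mono (Set.subset_union_left (t := squareRels V)) hx)

/-- The pure Artin group: the kernel of the natural surjection to the Coxeter group. -/
def pureArtinGroup (Γ : LabelledGraph V) : Subgroup Γ.ArtinGroup :=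
  (artinToCoxeter Γ).ker

/-- `P : Fin n → Set V` is a decomposition of `Γ` as a `2`-labelled join of
irreducible induced subgraphs. -/
def IsIrredDecomp (Γ : LabelledGraph V) (n : ℕ) (P : Fin n → Set V) : Prop :=
  (∀ i, (P i).Nonempty) ∧
  (⋃ i, P i) = Set.univ ∧
  (∀ i j, i ≠ j → Disjoint (P i) (P j)) ∧
  (∀ i j, i ≠ j → ∀ u ∈ P i, ∀ v ∈ P j, Γ.m u v = 2) ∧
  (∀ i, (Γ.induce (P i)).Irreducible)

/-- `Γ` satisfies the Center Conjecture if for the (finest) decomposition of `Γ` as a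
`2`-labelled join of irreducible induced subgraphs `Γ₁, …, Γₙ`, the center of the Artin
group `A_Γ` is free abelian of rank the number of spherical factors `Γᵢ`. -/
def SatisfiesCenterConjecture (Γ : LabelledGraph V) : Prop :=
  ∀ (n : ℕ) (P : Fin n → Set V), Γ.IsIrredDecomp n P →
    Nonempty ((Subgroup.center Γ.ArtinGroup) ≃*
      Multiplicative (Fin (Nat.card {i : Fin n // (Γ.induce (P i)).Spherical}) → ℤ))

/-- A monoid hom applied to an alternating product. -/
theorem map_altProd {G H : Type*} [Monoid G] [Monoid H] (φ : G →* H) (x y : G) (n : ℕ) :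
    φ (altProd x y n) = altProd (φ x) (φ y) n := by
  induction n generalizing x y with
  | zero => simp [altProd]
  | succ n ih => simp [altProd, ih]

/-- The homomorphism between Artin groups induced by a label-preserving injection of
labelled graphs, sending generators to generators. -/
def mapHom (Γ : LabelledGraph V) (Δ : LabelledGraph W) (f : V → W)
    (hf : ∀ u v : V, u ≠ v → f u ≠ f v)
    (hm : ∀ u v : V, Γ.m u v = Δ.m (f u) (f v)) :
    Γ.ArtinGroup →* Δ.ArtinGroup :=
  PresentedGroup.toGroup (f := fun v => Δ.σ (f v))
    (by
      rintro r ⟨u, v, k, huv, hk, rfl⟩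
      have key : ∀ (a b : V),
          FreeGroup.lift (fun v => Δ.σ (f v)) (altWord a b k)
            = PresentedGroup.mk Δ.artinRels (altWord (f a) (f b) k) := by
        intro a b
        rw [altWord, map_altProd, altWord, map_altProd]
        simp [σ, PresentedGroup.of]
      rw [map_mul, map_inv, key, key, ← map_inv, ← map_mul]
      refine (QuotientGroup.eq_one_iff _).mpr (Subgroup.subset_normalClosure ?_)
      exact ⟨f u, f v, k, hf u v huv, (hm u v) ▸ hk, rfl⟩)

@[simp]
theorem mapHom_σ (Γ : LabelledGraph V) (Δ : LabelledGraph W) (f : V → W)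
    (hf : ∀ u v : V, u ≠ v → f u ≠ f v)
    (hm : ∀ u v : V, Γ.m u v = Δ.m (f u) (f v)) (v : V) :
    mapHom Γ Δ f hf hm (Γ.σ v) = Δ.σ (f v) :=
  PresentedGroup.toGroup.of _

/-- The homomorphism between the Artin groups of induced subgraphs coming from an
inclusion `K' ⊆ K`. -/
def induceHom (Γ : LabelledGraph V) {K' K : Set V} (h : K' ⊆ K) :
    (Γ.induce K').ArtinGroup →* (Γ.induce K).ArtinGroup :=
  mapHom _ _ (Set.inclusion h)
    (fun _ _ huv e => huv (Set.inclusion_injective h e))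
    (fun _ _ => rfl)

/-- The homomorphism from the Artin group of an induced subgraph to the ambient
Artin group. -/
def inclHom (Γ : LabelledGraph V) (K : Set V) :
    (Γ.induce K).ArtinGroup →* Γ.ArtinGroup :=
  mapHom _ _ Subtype.val
    (fun _ _ huv e => huv (Subtype.ext e))
    (fun _ _ => rfl)

end LabelledGraph

namespace LabelledGraph

open Matrix

/-- Normal form of an alternating product of `1 + A` and `1 + B` when `A` and `B` satisfy
Temperley-Lieb type relations. -/
theorem altProd_one_add {R : Type*} [Ring R] [Algebra ℝ R] {q c : ℝ} {a g : ℕ → ℝ}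
    (a0 : a 0 = 0) (a1 : a 1 = 1) (g0 : g 0 = 0) (g1 : g 1 = 0)
    (ha : ∀ n, a (n + 2) = c * g (n + 1) - q * a n)
    (hg : ∀ n, g (n + 2) = a (n + 1) - q * g n) (n : ℕ) :
    ∀ {A B : R}, A * A = -(1 + q) • A → B * B = -(1 + q) • B →
      A * (B * A) = c • A → B * (A * B) = c • B →
      altProd (1 + A) (1 + B) (n + 1) =
        1 + (∑ i ∈ Finset.range (n + 2), a i) • A + (∑ i ∈ Finset.range (n + 1), a i) • B
          + (∑ i ∈ Finset.range (n + 2), g i) • (A * B)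
          + (∑ i ∈ Finset.range (n + 1), g i) • (B * A) := by
  have sum_a : ∀ n, ∑ i ∈ Finset.range (n + 3), a i =
      1 - q * (∑ i ∈ Finset.range (n + 1), a i) + c * ∑ i ∈ Finset.range (n + 2), g i := by
    intro n
    induction n with
    | zero => simp [Finset.sum_range_succ, a0, a1, g0, g1, ha 0]
    | succ n ih =>
      rw [Finset.sum_range_succ, ih, ha, Finset.sum_range_succ _ (n + 2),
        Finset.sum_range_succ a (n + 1)]
      ring
  have sum_g : ∀ n, ∑ i ∈ Finset.range (n + 3), g i =
      (∑ i ∈ Finset.range (n + 2), a i) - q * ∑ i ∈ Finset.range (n + 1), g i := by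
    intro n
    induction n with
    | zero => simp [Finset.sum_range_succ, a0, a1, g0, g1, hg 0]
    | succ n ih =>
      rw [Finset.sum_range_succ, ih, hg, Finset.sum_range_succ _ (n + 2),
        Finset.sum_range_succ g (n + 1)]
      ring
  induction n with
  | zero =>
    intro A B _ _ _ _
    simp [altProd, Finset.sum_range_succ, a0, a1, g0, g1]
  | succ n ih =>
    intro A B hA hB hAB hBA
    have hAAB : A * (A * B) = -(1 + q) • (A * B) := by
      rw [← mul_assoc, hA, smul_mul_assoc]
    rw [altProd, ih hB hA hBA hAB, sum_a, sum_g]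
    simp only [mul_add, add_mul, one_mul, mul_one, mul_smul_comm, hA, hAB, hAAB]
    module

/-- The braid relation for `1 + A` and `1 + B` under Temperley-Lieb type relations with
parameter `4 r² cos² (π / k)`. -/
theorem altProd_one_add_comm {R : Type*} [Ring R] [Algebra ℝ R] {r : ℝ} (hr : r ≠ 0) {k : ℕ}
    (hk : 3 ≤ k) {A B : R} (hA : A * A = -(1 + r ^ 2) • A) (hB : B * B = -(1 + r ^ 2) • B)
    (hAB : A * (B * A) = (2 * r * Real.cos (Real.pi / k)) ^ 2 • A)
    (hBA : B * (A * B) = (2 * r * Real.cos (Real.pi / k)) ^ 2 • B) :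
    altProd (1 + A) (1 + B) k = altProd (1 + B) (1 + A) k := by
  set θ := Real.pi / k with hθ
  have hk' : (3 : ℝ) ≤ k := by exact_mod_cast hk
  have hθ0 : 0 < θ := div_pos Real.pi_pos (by linarith)
  have hθ2 : θ < Real.pi / 2 := div_lt_div_of_pos_left Real.pi_pos (by norm_num) (by linarith)
  have hs : Real.sin θ ≠ 0 := (Real.sin_pos_of_pos_of_lt_pi hθ0 (by linarith)).ne'
  have hc : Real.cos θ ≠ 0 := (Real.cos_pos_of_mem_Ioo ⟨by linarith, hθ2⟩).ne'
  have hkθ : Real.sin (k * θ) = 0 := by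
    rw [hθ, mul_div_cancel₀ _ (by linarith : (k : ℝ) ≠ 0), Real.sin_pi]
  obtain ⟨S, hS⟩ : ∃ S : ℕ → ℝ, ∀ n, S n = r ^ n * Real.sin (n * θ) := ⟨_, fun _ => rfl⟩
  have hrec : ∀ n, S (n + 2) = 2 * r * Real.cos θ * S (n + 1) - r ^ 2 * S n := by
    intro n
    have h1 : ((n + 2 : ℕ) : ℝ) * θ = ((n + 1 : ℕ) : ℝ) * θ + θ := by push_cast; ring
    have h2 : (n : ℝ) * θ = ((n + 1 : ℕ) : ℝ) * θ - θ := by push_cast; ring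
    rw [hS, hS, hS, h1, h2, Real.sin_add, Real.sin_sub]
    ring
  let a : ℕ → ℝ := fun n => if Even n then 0 else S n / (r * Real.sin θ)
  let g : ℕ → ℝ := fun n =>
    if Even n then S n / (2 * r ^ 2 * Real.cos θ * Real.sin θ) else 0
  have ak : a k = 0 := by simp [a, hS, hkθ]
  have gk : g k = 0 := by simp [g, hS, hkθ]
  have a0 : a 0 = 0 := by simp [a]
  have a1 : a 1 = 1 := by simp [a, hS, hr, hs]
  have g0 : g 0 = 0 := by simp [g, hS]
  have g1 : g 1 = 0 := by simp [g]
  have ha : ∀ n, a (n + 2) = (2 * r * Real.cos θ) ^ 2 * g (n + 1) - r ^ 2 * a n := by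
    intro n
    rcases Nat.even_or_odd n with h | h
    · simp [a, g, h, Nat.even_add_one]
    · have h' : ¬ Even n := Nat.not_even_iff_odd.mpr h
      simp only [a, g, Nat.even_add_one, h', not_true, not_false_iff, if_true, if_false, hrec]
      field_simp
  have hg : ∀ n, g (n + 2) = a (n + 1) - r ^ 2 * g n := by
    intro n
    rcases Nat.even_or_odd n with h | h
    · simp only [a, g, Nat.even_add_one, h, not_true, not_false_iff, if_true, if_false, hrec]
      field_simp
    · simp [a, g, Nat.not_even_iff_odd.mpr h, Nat.even_add_one]
  obtain ⟨n, rfl⟩ : ∃ n, k = n + 1 := ⟨k - 1, by omega⟩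
  rw [altProd_one_add a0 a1 g0 g1 ha hg n hA hB hAB hBA,
    altProd_one_add a0 a1 g0 g1 ha hg n hB hA hBA hAB,
    Finset.sum_range_succ _ (n + 1), Finset.sum_range_succ _ (n + 1), ak, gk]
  module

/-- The deformed Gram matrix of `Γ`: the diagonal is `-(1 + r²)`, the entries at `(u, v)` and
`(v, u)` are `1`, and every other entry is `2 r cos (π / m s t)`. -/
noncomputable def gram {V : Type*} [DecidableEq V] (Γ : LabelledGraph V) (u v : V) (r : ℝ)
    (s t : V) : ℝ :=
  if s = t then -(1 + r ^ 2)
  else if (s = u ∧ t = v) ∨ (s = v ∧ t = u) then 1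
  else 2 * r * Real.cos (Real.pi / (Γ.m s t).toNat)

/-- The endomorphism `e_t ↦ gram s t • e_s`. -/
noncomputable def rankOne {V : Type*} [DecidableEq V] (Γ : LabelledGraph V) (u v : V) (r : ℝ)
    (s : V) : Matrix V V ℝ :=
  vecMulVec (Pi.single s 1) (gram Γ u v r s)

section Representation

variable {V : Type*} [DecidableEq V] (Γ : LabelledGraph V) (u v : V)

theorem gram_self (r : ℝ) (s : V) : gram Γ u v r s s = -(1 + r ^ 2) := by
  simp [gram]

theorem gram_of_ne_top (huv : Γ.m u v = ⊤) (r : ℝ) {s t : V} (hst : s ≠ t)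
    (hm : Γ.m s t ≠ ⊤) :
    gram Γ u v r s t = 2 * r * Real.cos (Real.pi / (Γ.m s t).toNat) := by
  rw [gram, if_neg hst, if_neg]
  rintro (⟨rfl, rfl⟩ | ⟨rfl, rfl⟩)
  · exact hm huv
  · exact hm (Γ.symm _ _ ▸ huv)

theorem gram_ne_zero {r : ℝ} (hr : 0 < r) {s t : V} (hst : s ≠ t) (hm : Γ.m s t ≠ 2) :
    gram Γ u v r s t ≠ 0 := by
  rw [gram, if_neg hst]
  split_ifs
  · exact one_ne_zero
  · refine mul_ne_zero (by positivity) ?_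
    rcases eq_or_ne (Γ.m s t) ⊤ with h | h
    · simp [h]
    · obtain ⟨k, hk⟩ := ENat.ne_top_iff_exists.mp h
      have h2 := Γ.two_le s t hst
      rw [← hk] at h2 hm ⊢
      have h2' : 2 ≤ k := by exact_mod_cast h2
      have hm' : k ≠ 2 := by rintro rfl; exact hm rfl
      have hk3 : (3 : ℝ) ≤ k := by exact_mod_cast (by omega : 3 ≤ k)
      have h0 : 0 < Real.pi / k := div_pos Real.pi_pos (by linarith)
      have hlt : Real.pi / k < Real.pi / 2 :=
        div_lt_div_of_pos_left Real.pi_pos (by norm_num) (by linarith)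
      exact (Real.cos_pos_of_mem_Ioo ⟨by linarith [Real.pi_pos], hlt⟩).ne'

theorem continuous_rankOne (s : V) : Continuous fun r => rankOne Γ u v r s := by
  refine continuous_matrix fun i j => ?_
  simp only [rankOne, vecMulVec_apply, gram]
  split_ifs <;> fun_prop

variable [Fintype V]

theorem rankOne_mul_rankOne (r : ℝ) (s t : V) :
    rankOne Γ u v r s * rankOne Γ u v r t =
      gram Γ u v r s t • vecMulVec (Pi.single s 1) (gram Γ u v r t) := by
  simp [rankOne, vecMulVec_mul_vecMulVec, vecMulVec_smul]

theorem rankOne_mul_self (r : ℝ) (s : V) :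
    rankOne Γ u v r s * rankOne Γ u v r s = -(1 + r ^ 2) • rankOne Γ u v r s := by
  rw [rankOne_mul_rankOne, gram_self, rankOne]

theorem rankOne_mul_mul (r : ℝ) (s t : V) :
    rankOne Γ u v r s * (rankOne Γ u v r t * rankOne Γ u v r s) =
      (gram Γ u v r s t * gram Γ u v r t s) • rankOne Γ u v r s := by
  rw [rankOne_mul_rankOne, mul_smul_comm, rankOne, vecMulVec_mul_vecMulVec]
  simp [vecMulVec_smul, smul_smul, mul_comm]

/-- The deformed reflection as an invertible matrix. -/
noncomputable def reflUnit {r : ℝ} (hr : 0 < r) (s : V) : (Matrix V V ℝ)ˣ where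
  val := 1 + rankOne Γ u v r s
  inv := 1 + (r ^ 2)⁻¹ • rankOne Γ u v r s
  val_inv := by
    simp only [mul_add, add_mul, one_mul, mul_one, mul_smul_comm, rankOne_mul_self]
    match_scalars <;> field_simp
    ring
  inv_val := by
    simp only [mul_add, add_mul, one_mul, mul_one, smul_mul_assoc, rankOne_mul_self]
    match_scalars <;> field_simp
    ring

theorem altProd_reflUnit (huv : Γ.m u v = ⊤) {r : ℝ} (hr : 0 < r) {s t : V} {k : ℕ}
    (hst : s ≠ t) (hk : Γ.m s t = k) :
    altProd (reflUnit Γ u v hr s) (reflUnit Γ u v hr t) k =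
      altProd (reflUnit Γ u v hr t) (reflUnit Γ u v hr s) k := by
  apply Units.ext
  have hcoe : ∀ x y : (Matrix V V ℝ)ˣ, ((altProd x y k : (Matrix V V ℝ)ˣ) : Matrix V V ℝ) =
      altProd (x : Matrix V V ℝ) y k := fun x y => map_altProd (Units.coeHom _) x y k
  rw [hcoe, hcoe]
  change altProd (1 + rankOne Γ u v r s) (1 + rankOne Γ u v r t) k =
    altProd (1 + rankOne Γ u v r t) (1 + rankOne Γ u v r s) k
  have hkt : Γ.m t s = k := Γ.symm s t ▸ hk
  have g1 := gram_of_ne_top Γ u v huv r hst (by simp [hk])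
  have g2 := gram_of_ne_top Γ u v huv r hst.symm (by simp [hkt])
  rw [hk, ENat.toNat_natCast] at g1
  rw [hkt, ENat.toNat_natCast] at g2
  have h2 : 2 ≤ k := by
    have := Γ.two_le s t hst
    rw [hk] at this
    exact_mod_cast this
  rcases h2.eq_or_lt with rfl | h3
  · have c1 : rankOne Γ u v r s * rankOne Γ u v r t = 0 := by
      simp [rankOne_mul_rankOne, g1]
    have c2 : rankOne Γ u v r t * rankOne Γ u v r s = 0 := by
      simp [rankOne_mul_rankOne, g2]
    simp only [altProd, mul_add, add_mul, one_mul, mul_one, c1, c2]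
    abel
  · refine altProd_one_add_comm hr.ne' h3 (rankOne_mul_self Γ u v r s)
      (rankOne_mul_self Γ u v r t) ?_ ?_
    · rw [rankOne_mul_mul, g1, g2, sq]
    · rw [rankOne_mul_mul, g1, g2, sq]

/-- The deformed reflection representation of the Artin group. -/
noncomputable def deformedRep (huv : Γ.m u v = ⊤) {r : ℝ} (hr : 0 < r) :
    Γ.ArtinGroup →* (Matrix V V ℝ)ˣ :=
  PresentedGroup.toGroup (f := reflUnit Γ u v hr) (by
    rintro _ ⟨s, t, k, hst, hk, rfl⟩
    rw [map_mul, map_inv, altWord, altWord, map_altProd, map_altProd, FreeGroup.lift_apply_of,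
      FreeGroup.lift_apply_of, altProd_reflUnit Γ u v huv hr hst hk, mul_inv_cancel])

theorem deformedRep_σ (huv : Γ.m u v = ⊤) {r : ℝ} (hr : 0 < r) (s : V) :
    (deformedRep Γ u v huv hr (Γ.σ s) : Matrix V V ℝ) = 1 + rankOne Γ u v r s :=
  congrArg Units.val (PresentedGroup.toGroup.of _)

/-- A matrix commuting with all deformed reflections of an irreducible graph is scalar. -/
theorem eq_scalar_of_commute (hirr : Γ.Irreducible) {r : ℝ} (hr : 0 < r) {M : Matrix V V ℝ}
    (hM : ∀ s, Commute M (1 + rankOne Γ u v r s)) : M = M u u • 1 := by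
  have hcomm : ∀ s i j, M i s * gram Γ u v r s j =
      if i = s then ∑ k, gram Γ u v r s k * M k j else 0 := by
    intro s i j
    have h : M * rankOne Γ u v r s = rankOne Γ u v r s * M := by
      have := (hM s).eq
      rwa [mul_add, add_mul, mul_one, one_mul, add_right_inj] at this
    have h' := congrFun (congrFun h i) j
    rw [rankOne, mul_vecMulVec, vecMulVec_mul] at h'
    simpa [vecMulVec_apply, Pi.single_apply, vecMul, dotProduct] using h'
  have hoff : ∀ i s, i ≠ s → M i s = 0 := by
    intro i s his
    have h := hcomm s i s
    rw [if_neg his, gram_self] at h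
    exact (mul_eq_zero.mp h).resolve_right (by nlinarith [sq_nonneg r])
  have hdiag : ∀ s t, gram Γ u v r s t ≠ 0 → M s s = M t t := by
    intro s t hst
    have h := hcomm s s t
    rw [if_pos rfl, Finset.sum_eq_single t (fun k _ hk => by rw [hoff k t hk, mul_zero])
      (by simp), mul_comm] at h
    exact mul_left_cancel₀ hst h
  have hall : ∀ s, M s s = M u u := by
    by_contra! hne
    obtain ⟨s, hs⟩ := hne
    refine hirr ⟨{t | M t t = M u u}, {t | M t t ≠ M u u}, ⟨u, rfl⟩, ⟨s, hs⟩, ?_, ?_, ?_⟩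
    · exact Set.disjoint_left.mpr fun t h h' => h' h
    · exact Set.eq_univ_of_forall fun t => em _
    · intro a ha b hb
      by_contra hm
      have hab : a ≠ b := by rintro rfl; exact hb ha
      exact hb ((hdiag a b (gram_ne_zero Γ u v hr hab hm)).symm.trans ha)
  ext i j
  rcases eq_or_ne i j with rfl | h
  · simp [hall i]
  · simp [hoff i j h, h]

theorem rankOne_zero_mulVec_self (s : V) :
    (1 + rankOne Γ u v 0 s) *ᵥ Pi.single s 1 = 0 := by
  ext i
  simp [rankOne, vecMulVec_apply, gram_self, Pi.single_apply, one_apply]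

theorem rankOne_zero_mulVec_pair (huv : u ≠ v) (s : V) :
    (1 + rankOne Γ u v 0 s) *ᵥ (Pi.single u 1 + Pi.single v 1) =
      Pi.single u 1 + Pi.single v 1 := by
  have h : gram Γ u v 0 s u + gram Γ u v 0 s v = 0 := by
    simp only [gram]
    by_cases hu : s = u
    · subst hu; simp [huv]
    · by_cases hv : s = v
      · subst hv; simp [huv.symm]
      · simp [hu, hv]
  ext i
  simp only [mulVec_add, mulVec_single_one, rankOne, Pi.add_apply, col_apply, Matrix.add_apply,
    vecMulVec_apply, one_apply, Pi.single_apply]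
  linear_combination (if i = s then (1 : ℝ) else 0) * h

end Representation

end LabelledGraph

open LabelledGraph Matrix in
/-- If `Γ` is irreducible and not a clique (some pair of distinct
vertices has label `∞`), then no nontrivial positive element of `A_Γ` is central. -/
theorem no_positive_central_element {V : Type*} [Finite V] (Γ : LabelledGraph V)
    (hirr : Γ.Irreducible) (hnotclique : ∃ u v : V, u ≠ v ∧ Γ.m u v = ⊤)
    (z : Γ.ArtinGroup) (hpos : z ∈ Submonoid.closure (Set.range Γ.σ)) (hz : z ≠ 1) :
    z ∉ Subgroup.center Γ.ArtinGroup := by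
  classical
  have := Fintype.ofFinite V
  obtain ⟨u, v, huv, hm⟩ := hnotclique
  intro hcen
  obtain ⟨L, rfl⟩ : ∃ L : List V, (L.map Γ.σ).prod = z := by
    obtain ⟨l, hl, rfl⟩ := Submonoid.exists_list_of_mem_closure hpos
    obtain ⟨L, rfl⟩ : l ∈ Set.range (List.map Γ.σ) := by rwa [Set.range_list_map]
    exact ⟨L, rfl⟩
  let M : ℝ → Matrix V V ℝ := fun r => (L.map fun s => 1 + rankOne Γ u v r s).prod
  have hMcont : Continuous M :=
    continuous_list_prod L fun s _ => continuous_const.add (continuous_rankOne Γ u v s)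
  have hscalar : ∀ r, 0 < r → M r = M r u u • 1 := by
    intro r hr
    have hMr : M r = (deformedRep Γ u v hm hr (L.map Γ.σ).prod : Matrix V V ℝ) := by
      rw [map_list_prod, ← Units.coeHom_apply, map_list_prod, List.map_map, List.map_map]
      refine congrArg List.prod (List.map_congr_left fun s _ => ?_)
      exact (deformedRep_σ Γ u v hm hr s).symm
    refine eq_scalar_of_commute Γ u v hirr hr fun s => ?_
    rw [hMr, ← deformedRep_σ Γ u v hm hr s, commute_iff_eq, ← Units.val_mul, ← Units.val_mul,
      ← map_mul, ← map_mul, Subgroup.mem_center_iff.mp hcen]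
  have hscalar0 : M 0 = M 0 u u • 1 := by
    have hclosed : IsClosed {r | M r = M r u u • 1} :=
      isClosed_eq hMcont ((hMcont.matrix_elem u u).smul continuous_const)
    have h := closure_minimal (s := Set.Ioi (0 : ℝ)) hscalar hclosed
    rw [closure_Ioi] at h
    exact h (Set.mem_Ici.mpr le_rfl)
  have hfix : M 0 *ᵥ (Pi.single u 1 + Pi.single v 1) = Pi.single u 1 + Pi.single v 1 := by
    simp only [M]
    clear * - huv
    induction L with
    | nil => simp
    | cons s L ih =>
      rw [List.map_cons, List.prod_cons, ← mulVec_mulVec, ih, rankOne_zero_mulVec_pair Γ u v huv]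
  have hzero : M 0 u u = 0 := by
    obtain ⟨K, s, rfl⟩ := List.eq_nil_or_concat L |>.resolve_left (by rintro rfl; exact hz rfl)
    have h : M 0 *ᵥ Pi.single s 1 = 0 := by
      simp only [M, List.concat_eq_append, List.map_append, List.prod_append, List.map_singleton,
        List.prod_singleton]
      rw [← mulVec_mulVec, rankOne_zero_mulVec_self, mulVec_zero]
    rw [hscalar0] at h
    simpa [smul_mulVec] using congrFun h s
  rw [hscalar0, hzero, zero_smul, zero_mulVec] at hfix
  simpa [huv] using congrFun hfix u
end

section
/- If every Artin group whose defining labelled graph is a clique (i.e., m(u,v) < ∞ for all distinct vertices u, v) satisfies the Center Conjecture, then every Artin group satisfies the Center Conjecture. -/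
universe u

namespace LabelledGraph

section AltProd

variable {G : Type*}

theorem altProd_two_mul [Monoid G] (x y : G) (n : ℕ) : altProd x y (2 * n) = (x * y) ^ n := by
  induction n with
  | zero => simp [altProd]
  | succ n ih => rw [mul_add, mul_one, altProd, altProd, ih, pow_succ', mul_assoc]

/-- The alternating product `⋯ * x * y * x` with `n` terms, whose last factor is `x`. -/
def altProdRev [Monoid G] (x y : G) : ℕ → G
  | 0 => 1
  | n + 1 => altProdRev y x n * x

theorem altProdRev_succ_left [Monoid G] (x y : G) (n : ℕ) :
    altProdRev x y (n + 1) = (if Even n then x else y) * altProdRev x y n := by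
  induction n generalizing x y with
  | zero => simp [altProdRev]
  | succ n ih =>
    rw [altProdRev, ih, altProdRev]
    by_cases h : Even n <;> simp [Nat.even_add_one, h, mul_assoc]

theorem altProdRev_eq [Monoid G] (x y : G) (n : ℕ) :
    altProdRev x y n = if Even n then altProd y x n else altProd x y n := by
  induction n with
  | zero => simp [altProd, altProdRev]
  | succ n ih =>
    rw [altProdRev_succ_left, ih]
    by_cases h : Even n <;> simp [Nat.even_add_one, h, altProd]

theorem altProdRev_comm_iff [Monoid G] (x y : G) (n : ℕ) :
    altProdRev x y n = altProdRev y x n ↔ altProd x y n = altProd y x n := by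
  rw [altProdRev_eq, altProdRev_eq]
  split_ifs
  · exact eq_comm
  · rfl

theorem altProdRev_mul_altProd [Monoid G] {x y : G} (hx : x * x = 1) (hy : y * y = 1) (n : ℕ) :
    altProdRev x y n * altProd x y n = 1 := by
  induction n generalizing x y with
  | zero => simp [altProd, altProdRev]
  | succ n ih =>
    rw [altProd, altProdRev, mul_assoc, ← mul_assoc x x, hx, one_mul, ih hy hx]

theorem altProd_add [Monoid G] (x y : G) (k n : ℕ) :
    altProd x y (k + n) =
      altProd x y k * (if Even k then altProd x y n else altProd y x n) := by
  induction k generalizing x y with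
  | zero => simp [altProd]
  | succ k ih =>
    rw [Nat.add_right_comm, altProd, ih, altProd, mul_assoc]
    by_cases h : Even k <;> simp [Nat.even_add_one, h]

theorem altProd_comm_iff_pow_eq_one [Group G] {x y : G} (hx : x * x = 1) (hy : y * y = 1)
    (n : ℕ) : altProd x y n = altProd y x n ↔ (x * y) ^ n = 1 := by
  have key : (if Even n then altProd x y n else altProd y x n) = altProdRev y x n := by
    rw [altProdRev_eq]
  have h := altProdRev_mul_altProd hy hx n
  rw [← altProd_two_mul, two_mul, altProd_add, key, ← eq_inv_iff_mul_eq_one,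
    inv_eq_of_mul_eq_one_right h]

end AltProd

end LabelledGraph

namespace CoxeterMatrix

open Module Polynomial.Chebyshev

variable {B : Type*} (M : CoxeterMatrix B)

/-- The linear form `2 B(αᵢ, -)` of the geometric representation. -/
noncomputable def coroot (i : B) : Dual ℝ (B →₀ ℝ) :=
  Finsupp.linearCombination ℝ fun j => -2 * Real.cos (Real.pi / M i j)

theorem coroot_single (i j : B) :
    M.coroot i (Finsupp.single j 1) = -2 * Real.cos (Real.pi / M i j) := by
  simp [coroot]

theorem coroot_self (i : B) : M.coroot i (Finsupp.single i 1) = 2 := by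
  simp [coroot]

/-- The reflection attached to a vertex in the geometric representation. -/
noncomputable def simpleReflection (i : B) : (B →₀ ℝ) ≃ₗ[ℝ] (B →₀ ℝ) :=
  reflection (M.coroot_self i)

theorem coroot_mul_coroot (i j : B) :
    M.coroot i (Finsupp.single j 1) * M.coroot j (Finsupp.single i 1) - 2 =
      2 * Real.cos (2 * Real.pi / M i j) := by
  rw [coroot_single, coroot_single, M.symmetric j i, mul_div_assoc, Real.cos_two_mul]
  ring

theorem simpleReflection_mul_pow (i j : B) :
    (M.simpleReflection i * M.simpleReflection j) ^ M i j = 1 := by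
  obtain rfl | hij := eq_or_ne i j
  · ext1 v
    simpa [simpleReflection] using involutive_reflection (M.coroot_self i) v
  obtain h0 | h0 := Nat.eq_zero_or_pos (M i j)
  · simp [h0]
  have h1 := M.off_diagonal i j hij
  ext1 z
  have key := reflection_mul_reflection_pow_apply (M.coroot_self i) (M.coroot_self j) (M i j) z
    (2 * Real.cos (2 * Real.pi / M i j)) (M.coroot_mul_coroot i j).symm
  have hc := M.coroot_single i j
  have hc' := M.coroot_single j i
  rw [M.symmetric j i] at hc'
  change _ = z
  rw [simpleReflection, simpleReflection, key]
  generalize hm : M i j = m at *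
  obtain rfl | h3 : m = 2 ∨ 3 ≤ m := by omega
  · simp at hc hc'
    norm_num [hc, hc']
    abel
  have hθ : 0 < Real.sin (2 * Real.pi / m) := by
    apply Real.sin_pos_of_pos_of_lt_pi
    · positivity
    · rw [div_lt_iff₀ (by positivity)]
      have : (3 : ℝ) ≤ m := by exact_mod_cast h3
      nlinarith [Real.pi_pos]
  have hS := fun n => S_two_mul_real_cos (2 * Real.pi / m) n
  set θ := 2 * Real.pi / m with hθ'
  have hm0 : (m : ℝ) ≠ 0 := by positivity
  have hmθ : (m : ℝ) * θ = 2 * Real.pi := by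
    rw [hθ']
    field_simp
  have key : (S ℝ ((m - 2 : ℤ) / 2)).eval (2 * Real.cos θ) *
      ((S ℝ ((m - 1 : ℤ) / 2)).eval (2 * Real.cos θ) +
        (S ℝ ((m - 3 : ℤ) / 2)).eval (2 * Real.cos θ)) = 0 ∧
      (S ℝ ((m - 1 : ℤ) / 2)).eval (2 * Real.cos θ) *
      ((S ℝ ((m : ℤ) / 2)).eval (2 * Real.cos θ) +
        (S ℝ ((m - 2 : ℤ) / 2)).eval (2 * Real.cos θ)) = 0 := by
    obtain ⟨k, rfl | rfl⟩ := m.even_or_odd'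
    · have h1 : (((2 * k : ℕ) : ℤ) - 2) / 2 = k - 1 := by omega
      have h2 : (((2 * k : ℕ) : ℤ) - 1) / 2 = k - 1 := by omega
      have h : (S ℝ ((k : ℤ) - 1)).eval (2 * Real.cos θ) = 0 := by
        have := hS ((k : ℤ) - 1)
        have h3 : (((k : ℤ) - 1 : ℤ) + 1 : ℝ) * θ = Real.pi := by
          push_cast at hmθ ⊢
          linarith
        rw [h3, Real.sin_pi] at this
        exact (mul_eq_zero.mp this).resolve_right hθ.ne'
      rw [h1, h2, h]
      simp
    · have h1 : (((2 * k + 1 : ℕ) : ℤ) - 1) / 2 = k := by omega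
      have h2 : (((2 * k + 1 : ℕ) : ℤ) - 3) / 2 = k - 1 := by omega
      have h3 : (((2 * k + 1 : ℕ) : ℤ)) / 2 = k := by omega
      have h4 : (((2 * k + 1 : ℕ) : ℤ) - 2) / 2 = k - 1 := by omega
      have h : (S ℝ (k : ℤ)).eval (2 * Real.cos θ) +
          (S ℝ ((k : ℤ) - 1)).eval (2 * Real.cos θ) = 0 := by
        have e1 := hS (k : ℤ)
        have e2 := hS ((k : ℤ) - 1)
        have e3 : ((k : ℤ) + 1 : ℝ) * θ = 2 * Real.pi - (((k : ℤ) - 1 : ℤ) + 1 : ℝ) * θ := by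
          push_cast at hmθ ⊢
          linarith
        rw [e3, Real.sin_two_pi_sub, ← e2, ← neg_mul] at e1
        have := mul_right_cancel₀ hθ.ne' e1
        linarith
      rw [h1, h2, h3, h4, h]
      simp
  rw [key.1, key.2]
  simp

theorem dvd_of_simpleReflection_mul_pow_eq_one (i j : B) (k : ℕ)
    (h : (M.simpleReflection i * M.simpleReflection j) ^ k = 1) : M i j ∣ k := by
  obtain rfl | hij := eq_or_ne i j
  · simp
  have key := reflection_mul_reflection_pow_apply_self (M.coroot_self i) (M.coroot_self j) k
    (2 * Real.cos (2 * Real.pi / M i j)) (M.coroot_mul_coroot i j).symm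
  change ((M.simpleReflection i * M.simpleReflection j) ^ k) _ = _ at key
  rw [h] at key
  have hx := DFunLike.congr_fun key i
  have hy := DFunLike.congr_fun key j
  simp only [LinearEquiv.coe_one, id_eq, Finsupp.add_apply, Finsupp.smul_apply, smul_eq_mul,
    Finsupp.single_eq_same, Finsupp.single_eq_of_ne hij, Finsupp.single_eq_of_ne hij.symm,
    mul_one, mul_zero, add_zero, zero_add, coroot_single] at hx hy
  rw [M.symmetric j i] at hy
  have h1 := M.off_diagonal i j hij
  clear key h
  generalize M i j = m at *
  obtain rfl | rfl | h3 : m = 0 ∨ m = 2 ∨ 3 ≤ m := by omega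
  · simp only [CharP.cast_eq_zero, div_zero, Real.cos_zero, mul_one, S_eval_two] at hx
    push_cast at hx
    have : (k : ℝ) = 0 := by linarith
    simpa using this
  · have e : 2 * Real.cos (2 * Real.pi / (2 : ℕ)) = -2 := by simp
    rw [e, S_eval_neg_two, S_eval_neg_two, Int.negOnePow_sub] at hx
    obtain h | h := k.even_or_odd
    · exact h.two_dvd
    · rw [Int.negOnePow_odd k (by exact_mod_cast h)] at hx
      norm_num at hx
  have hθ : 0 < Real.sin (2 * Real.pi / m) := by
    apply Real.sin_pos_of_pos_of_lt_pi
    · positivity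
    · rw [div_lt_iff₀ (by positivity)]
      have : (3 : ℝ) ≤ m := by exact_mod_cast h3
      nlinarith [Real.pi_pos]
  have hc : 0 < Real.cos (Real.pi / m) := by
    apply Real.cos_pos_of_mem_Ioo
    have : (3 : ℝ) ≤ m := by exact_mod_cast h3
    have h0 : 0 < Real.pi / m := by positivity
    refine ⟨by linarith [Real.pi_pos], ?_⟩
    rw [div_lt_div_iff₀ (by positivity) (by positivity)]
    nlinarith [Real.pi_pos]
  have hS := fun n => S_two_mul_real_cos (2 * Real.pi / m) n
  have h0 : (S ℝ ((k : ℤ) - 1)).eval (2 * Real.cos (2 * Real.pi / m)) = 0 := by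
    refine (mul_eq_zero.mp hy.symm).resolve_right ?_
    simp [hc.ne']
  have hk : (S ℝ (k : ℤ)).eval (2 * Real.cos (2 * Real.pi / m)) = 1 := by
    rw [h0, add_zero] at hx
    exact hx.symm
  have e1 := hS k
  have e2 := hS (k - 1)
  rw [hk, one_mul] at e1
  rw [h0, zero_mul] at e2
  push_cast at e1 e2
  rw [sub_add_cancel] at e2
  rw [add_mul, one_mul, Real.sin_add, ← e2, zero_mul, zero_add] at e1
  have e3 : Real.cos (k * (2 * Real.pi / m)) = 1 := by
    apply mul_right_cancel₀ hθ.ne'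
    rw [← e1, one_mul]
  obtain ⟨n, hn⟩ := (Real.cos_eq_one_iff _).mp e3
  have hm0 : (m : ℝ) ≠ 0 := by positivity
  have e4 : (k : ℝ) = n * m := by
    have hp := Real.pi_pos.ne'
    field_simp at hn
    linarith
  have e5 : (k : ℤ) = n * m := by exact_mod_cast e4
  exact Int.natCast_dvd_natCast.mp ⟨n, by rw [e5, mul_comm]⟩

end CoxeterMatrix

namespace CoxeterSystem

variable {B W : Type*} [Group W] {M : CoxeterMatrix B} (cs : CoxeterSystem M W)

theorem simple_mul_simple_pow_eq_one_iff (i j : B) (k : ℕ) :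
    (cs.simple i * cs.simple j) ^ k = 1 ↔ M i j ∣ k := by
  refine ⟨fun h => ?_, ?_⟩
  · apply M.dvd_of_simpleReflection_mul_pow_eq_one
    have hl : M.IsLiftable M.simpleReflection := M.simpleReflection_mul_pow
    have := congrArg (cs.lift ⟨M.simpleReflection, hl⟩) h
    rwa [map_pow, map_mul, map_one, cs.lift_apply_simple, cs.lift_apply_simple] at this
  · rintro ⟨c, rfl⟩
    rw [pow_mul, cs.simple_mul_simple_pow, one_pow]

theorem simple_injective : Function.Injective cs.simple := by
  intro i j h
  have := (cs.simple_mul_simple_pow_eq_one_iff i j 1).mp (by simp [h])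
  by_contra hij
  exact M.off_diagonal i j hij (Nat.dvd_one.mp this)

end CoxeterSystem

namespace CoxeterSystem

open List

variable {B W : Type*} [Group W] {M : CoxeterMatrix B} (cs : CoxeterSystem M W)

section Exchange

open Classical in
/-- The action of a simple reflection on signed group elements: conjugation, together with a
sign change at the reflection itself. -/
noncomputable def signedConj (i : B) : Equiv.Perm (W × ZMod 2) :=
  Function.Involutive.toPerm
    (fun p => (cs.simple i * p.1 * cs.simple i, p.2 + if p.1 = cs.simple i then 1 else 0)) (by
      rintro ⟨w, e⟩
      have h : cs.simple i * w * cs.simple i = cs.simple i ↔ w = cs.simple i := by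
        rw [mul_eq_right, ← inv_simple, inv_mul_eq_one, inv_simple, eq_comm]
      simp only [h, Prod.mk.injEq, add_assoc, CharTwo.add_self_eq_zero, add_zero, and_true]
      simp [mul_assoc])

open Classical in
theorem signedConj_apply (i : B) (p : W × ZMod 2) : cs.signedConj i p =
    (cs.simple i * p.1 * cs.simple i, p.2 + if p.1 = cs.simple i then 1 else 0) := rfl

theorem simple_mul_pow (i j : B) (k : ℕ) :
    cs.simple j * (cs.simple i * cs.simple j) ^ k =
      ((cs.simple i * cs.simple j) ^ k)⁻¹ * cs.simple j := by
  induction k with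
  | zero => simp
  | succ k ih =>
    rw [pow_succ, ← mul_assoc, ih, ← pow_succ, pow_succ']
    simp only [mul_inv_rev, inv_simple, mul_assoc]

open Classical in
theorem signedConj_mul_pow_apply (i j : B) (k : ℕ) (w : W) (e : ZMod 2) :
    ((cs.signedConj i * cs.signedConj j) ^ k) (w, e) =
      ((cs.simple i * cs.simple j) ^ k * w * ((cs.simple i * cs.simple j) ^ k)⁻¹,
        e + ∑ n ∈ Finset.range (2 * k),
          if w = ((cs.simple i * cs.simple j) ^ n)⁻¹ * cs.simple j then 1 else 0) := by
  induction k with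
  | zero => simp
  | succ k ih =>
    rw [pow_succ', Equiv.Perm.mul_apply, ih, mul_add, mul_one,
      Finset.sum_range_succ, Finset.sum_range_succ, ← add_assoc, ← add_assoc]
    have h := cs.simple_mul_pow i j k
    set ρ := cs.simple i * cs.simple j with hρ
    have h1 : ρ ^ k * w * (ρ ^ k)⁻¹ = cs.simple j ↔ w = (ρ ^ (2 * k))⁻¹ * cs.simple j := by
      rw [two_mul, pow_add, mul_inv_rev, mul_assoc (ρ ^ k)⁻¹, ← h, mul_inv_eq_iff_eq_mul,
        ← eq_inv_mul_iff_mul_eq]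
    have h2 : cs.simple j * (ρ ^ k * w * (ρ ^ k)⁻¹) * cs.simple j = cs.simple i ↔
        w = (ρ ^ (2 * k + 1))⁻¹ * cs.simple j := by
      have e : cs.simple j * cs.simple i * cs.simple j = ρ⁻¹ * cs.simple j := by
        simp [hρ]
      have e' : cs.simple j * (ρ ^ k * w * (ρ ^ k)⁻¹) * cs.simple j = cs.simple i ↔
          ρ ^ k * w * (ρ ^ k)⁻¹ = cs.simple j * cs.simple i * cs.simple j := by
        constructor
        · rintro h
          rw [← h]
          simp [mul_assoc]
        · intro h
          rw [h]
          simp [mul_assoc]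
      rw [e', e, mul_inv_eq_iff_eq_mul, ← eq_inv_mul_iff_mul_eq, mul_assoc, h, pow_succ',
        two_mul, pow_add]
      simp only [mul_inv_rev, mul_assoc]
      rw [← mul_assoc ρ⁻¹, ← mul_assoc (ρ ^ k)⁻¹ ρ⁻¹, ← mul_inv_rev, ← mul_inv_rev, ← pow_succ,
        ← pow_succ']
    simp only [Equiv.Perm.mul_apply, signedConj_apply, h1, h2]
    simp only [Prod.mk.injEq, and_true]
    rw [pow_succ']
    simp only [hρ, mul_inv_rev, inv_simple, mul_assoc]

theorem isLiftable_signedConj : M.IsLiftable cs.signedConj := by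
  classical
  intro i j
  ext1 ⟨w, e⟩
  rw [signedConj_mul_pow_apply, two_mul, Finset.sum_range_add]
  simp [pow_add, CharTwo.add_self_eq_zero]

/-- The signed conjugation action of the Coxeter group. -/
noncomputable def signedConjHom : W →* Equiv.Perm (W × ZMod 2) :=
  cs.lift ⟨cs.signedConj, cs.isLiftable_signedConj⟩

open Classical in
theorem signedConjHom_wordProd (ω : List B) (w : W) (e : ZMod 2) :
    cs.signedConjHom (cs.wordProd ω) (w, e) =
      (cs.wordProd ω * w * (cs.wordProd ω)⁻¹, e + ((cs.rightInvSeq ω).count w : ℕ)) := by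
  induction ω with
  | nil => simp
  | cons i ω ih =>
    have h : cs.signedConjHom (cs.simple i) = cs.signedConj i :=
      cs.lift_apply_simple cs.isLiftable_signedConj i
    rw [wordProd_cons, map_mul, Equiv.Perm.mul_apply, ih, h, signedConj_apply,
      rightInvSeq, List.count_cons]
    have h1 : cs.wordProd ω * w * (cs.wordProd ω)⁻¹ = cs.simple i ↔
        (cs.wordProd ω)⁻¹ * cs.simple i * cs.wordProd ω = w := by
      rw [mul_inv_eq_iff_eq_mul, mul_assoc (cs.wordProd ω)⁻¹, inv_mul_eq_iff_eq_mul, eq_comm]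
    simp only [h1, beq_iff_eq, Prod.mk.injEq]
    refine ⟨by simp [mul_assoc], ?_⟩
    split_ifs <;> simp [add_assoc]

theorem simple_mem_rightInvSeq {ω : List B} {i : B}
    (h : cs.IsRightDescent (cs.wordProd ω) i) : cs.simple i ∈ cs.rightInvSeq ω := by
  classical
  by_contra hn
  obtain ⟨ν, hν, hw⟩ := cs.exists_isReduced (cs.wordProd ω * cs.simple i)
  have e1 := cs.signedConjHom_wordProd ω (cs.simple i) 0
  rw [List.count_eq_zero_of_not_mem hn] at e1
  have e3 : cs.wordProd ω = cs.wordProd ν * cs.simple i := by simp [← hw]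
  have h' : cs.signedConjHom (cs.simple i) = cs.signedConj i :=
    cs.lift_apply_simple cs.isLiftable_signedConj i
  have e4 := cs.signedConjHom_wordProd ν (cs.simple i) 1
  rw [e3, map_mul, Equiv.Perm.mul_apply, h', signedConj_apply] at e1
  simp only [simple_mul_simple_self, one_mul, if_true, zero_add] at e1
  rw [e4] at e1
  have e5 := congrArg Prod.snd e1
  simp only [Nat.cast_zero] at e5
  have e6 : cs.simple i ∈ cs.rightInvSeq ν := by
    by_contra hn'
    rw [List.count_eq_zero_of_not_mem hn'] at e5
    simp at e5
  have := (cs.isRightInversion_of_mem_rightInvSeq hν e6).2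
  rw [← hw, mul_assoc, simple_mul_simple_self, mul_one] at this
  exact absurd h (not_lt.mpr this.le)

/-- The exchange condition. -/
theorem exists_wordProd_eraseIdx {ω : List B} {i : B}
    (h : cs.IsRightDescent (cs.wordProd ω) i) :
    ∃ j < ω.length, cs.wordProd ω * cs.simple i = cs.wordProd (ω.eraseIdx j) := by
  obtain ⟨j, hj, e⟩ := List.mem_iff_getElem.mp (cs.simple_mem_rightInvSeq h)
  refine ⟨j, by simpa using hj, ?_⟩
  rw [← cs.wordProd_mul_getD_rightInvSeq, ← e, List.getD_eq_getElem _ _ hj]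

end Exchange

end CoxeterSystem

namespace CoxeterSystem

open List

variable {B W : Type*} [Group W] {M : CoxeterMatrix B} (cs : CoxeterSystem M W)

section Parabolic

/-- The standard parabolic subgroup generated by a set of simple reflections. -/
def parabolic (X : Set B) : Subgroup W := Subgroup.closure (cs.simple '' X)

/-- The elements of `W` without right descents in `X`. -/
def minReps (X : Set B) : Set W := {w | ∀ t ∈ X, ¬ cs.IsRightDescent w t}

variable {cs} {X K : Set B}

theorem simple_mem_parabolic {i : B} (hi : i ∈ X) : cs.simple i ∈ cs.parabolic X :=
  Subgroup.subset_closure ⟨i, hi, rfl⟩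

theorem one_mem_minReps : (1 : W) ∈ cs.minReps X := fun t _ => cs.not_isRightDescent_one t

theorem mul_simple_notMem_minReps {w : W} (hw : w ∈ cs.minReps X) {t : B} (ht : t ∈ X) :
    w * cs.simple t ∉ cs.minReps X := fun h =>
  hw t ht (cs.isRightDescent_iff_not_isRightDescent_mul.mpr (h t ht))

theorem exists_simple_mul_eq_mul_simple {w : W} (hw : w ∈ cs.minReps X) {i : B}
    (h : cs.simple i * w ∉ cs.minReps X) : ∃ t ∈ X, cs.simple i * w = w * cs.simple t := by
  obtain ⟨ω, hω, rfl⟩ := cs.exists_isReduced w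
  simp only [minReps, Set.mem_ofPred_eq, not_forall, not_not] at h
  obtain ⟨t, ht, h⟩ := h
  refine ⟨t, ht, ?_⟩
  rw [← wordProd_cons] at h ⊢
  obtain ⟨j, hj, e⟩ := cs.exists_wordProd_eraseIdx h
  cases j with
  | zero =>
    rw [List.eraseIdx_cons_zero] at e
    rw [← e, mul_assoc, simple_mul_simple_self, mul_one]
  | succ j =>
    exfalso
    rw [List.eraseIdx_cons_succ, wordProd_cons, wordProd_cons, mul_assoc, mul_right_inj] at e
    apply hw t ht
    rw [IsRightDescent, e, hω.eq]
    have hj' : j < ω.length := by simpa using hj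
    refine (cs.length_wordProd_le _).trans_lt ?_
    rw [List.length_eraseIdx_of_lt hj']
    omega

theorem exists_word_of_mem_parabolic {d : W}
    (hd : ∀ y ∈ cs.parabolic K, cs.length d ≤ cs.length (d * y)) {y : W}
    (hy : y ∈ cs.parabolic K) : ∃ ω : List B, (∀ i ∈ ω, i ∈ K) ∧ y = cs.wordProd ω ∧
      cs.length (d * y) = cs.length d + ω.length := by
  have step : ∀ (y : W) (k : B), y ∈ cs.parabolic K → k ∈ K →
      (∃ ω : List B, (∀ i ∈ ω, i ∈ K) ∧ y = cs.wordProd ω ∧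
        cs.length (d * y) = cs.length d + ω.length) →
      ∃ ω : List B, (∀ i ∈ ω, i ∈ K) ∧ y * cs.simple k = cs.wordProd ω ∧
        cs.length (d * (y * cs.simple k)) = cs.length d + ω.length := by
    rintro y k hy hk ⟨ω, hω, rfl, hl⟩
    rw [← mul_assoc]
    by_cases h : cs.IsRightDescent (d * cs.wordProd ω) k
    · obtain ⟨δ, hδ, rfl⟩ := cs.exists_isReduced d
      have h' := h
      rw [← wordProd_append] at h'
      obtain ⟨j, hj, e⟩ := cs.exists_wordProd_eraseIdx h'
      rw [wordProd_append] at e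
      obtain hj' | hj' := lt_or_ge j δ.length
      · exfalso
        rw [List.eraseIdx_append_of_lt_length hj', wordProd_append] at e
        have h1 := hd _ (mul_mem (mul_mem hy (simple_mem_parabolic hk)) (inv_mem hy))
        rw [← mul_assoc, ← mul_assoc, e, mul_inv_cancel_right, hδ.eq] at h1
        have h2 := h1.trans (cs.length_wordProd_le _)
        rw [List.length_eraseIdx_of_lt hj'] at h2
        omega
      · rw [List.eraseIdx_append_of_length_le hj', wordProd_append, mul_assoc, mul_right_inj] at e
        rw [List.length_append] at hj
        refine ⟨_, fun i hi => hω i (List.mem_of_mem_eraseIdx hi), e, ?_⟩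
        rw [List.length_eraseIdx_of_lt (by omega)]
        have := cs.isRightDescent_iff.mp h
        omega
    · refine ⟨ω ++ [k], ?_, by simp [wordProd_append], ?_⟩
      · intro i hi
        rw [List.mem_append, List.mem_singleton] at hi
        obtain hi | rfl := hi
        exacts [hω i hi, hk]
      · rw [cs.not_isRightDescent_iff.mp h, hl]
        simp [add_assoc]
  refine Subgroup.closure_induction_right (p := fun y _ => ∃ ω : List B, (∀ i ∈ ω, i ∈ K) ∧
      y = cs.wordProd ω ∧ cs.length (d * y) = cs.length d + ω.length) ?_ ?_ ?_ hy
  · exact ⟨[], by simp, by simp, by simp⟩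
  · rintro y hy _ ⟨k, hk, rfl⟩ h
    exact step y k hy hk h
  · rintro y hy _ ⟨k, hk, rfl⟩ h
    rw [inv_simple]
    exact step y k hy hk h

theorem eq_one_of_mul_mem_minReps {d : W}
    (hd : ∀ y ∈ cs.parabolic K, cs.length d ≤ cs.length (d * y)) {y : W}
    (hy : y ∈ cs.parabolic K) (h : d * y ∈ cs.minReps K) : y = 1 := by
  obtain ⟨ω, hω, rfl, hl⟩ := exists_word_of_mem_parabolic hd hy
  obtain rfl | ⟨ω, k, rfl⟩ := ω.eq_nil_or_concat'
  · simp
  · exfalso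
    refine h k (hω k (by simp)) ?_
    rw [IsRightDescent, hl, wordProd_append, wordProd_singleton, ← mul_assoc,
      simple_mul_simple_cancel_right, List.length_append, List.length_singleton]
    have h1 := cs.length_mul_le d (cs.wordProd ω)
    have h2 := cs.length_wordProd_le ω
    omega

theorem exists_length_minimal (w : W) (D X : Set B) :
    ∃ y ∈ cs.parabolic D, ∃ x ∈ cs.parabolic X, ∀ y' ∈ cs.parabolic D, ∀ x' ∈ cs.parabolic X,
      cs.length (y * w * x) ≤ cs.length (y' * (y * w * x) * x') := by
  let S : Set ℕ := {n | ∃ y ∈ cs.parabolic D, ∃ x ∈ cs.parabolic X, cs.length (y * w * x) = n}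
  have hS : S.Nonempty := ⟨_, 1, one_mem _, 1, one_mem _, rfl⟩
  obtain ⟨y, hy, x, hx, e⟩ := Nat.sInf_mem hS
  refine ⟨y, hy, x, hx, fun y' hy' x' hx' => ?_⟩
  rw [e]
  refine Nat.sInf_le ⟨y' * y, mul_mem hy' hy, x * x', mul_mem hx hx', ?_⟩
  simp only [mul_assoc]

theorem length_le_of_mem_minReps {w : W} (hw : w ∈ cs.minReps K) {y : W}
    (hy : y ∈ cs.parabolic K) : cs.length w ≤ cs.length (w * y) := by
  obtain ⟨y', hy', x, hx, h⟩ := exists_length_minimal (cs := cs) w ∅ K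
  obtain rfl : y' = 1 := by simpa [parabolic] using hy'
  simp only [one_mul] at h
  have e : w * x * x⁻¹ = w := by simp
  have h1 := eq_one_of_mul_mem_minReps (d := w * x) (y := x⁻¹)
    (fun y hy => by simpa using h 1 (one_mem _) y hy) (inv_mem hx) (by rwa [e])
  rw [inv_eq_one] at h1
  simpa [h1] using h 1 (one_mem _) y hy

theorem eq_of_mem_minReps {w y : W} (hw : w ∈ cs.minReps K) (hy : y ∈ cs.parabolic K)
    (h : w * y ∈ cs.minReps K) : w * y = w := by
  rw [eq_one_of_mul_mem_minReps (fun _ => length_le_of_mem_minReps hw) hy h, mul_one]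

theorem exists_eq_simple_of_mul_eq_mul_simple {d ρ : W} (hd : d ∈ cs.minReps X)
    (hd' : d⁻¹ ∈ cs.minReps K) (hρ : ρ ∈ cs.parabolic K) {t : B} (ht : t ∈ X)
    (h : ρ * d = d * cs.simple t) : ∃ k ∈ K, ρ = cs.simple k := by
  obtain ⟨ω, hω, e, hl⟩ := exists_word_of_mem_parabolic
    (fun _ => length_le_of_mem_minReps hd') (inv_mem hρ)
  rw [← mul_inv_rev, length_inv, length_inv, h, cs.not_isRightDescent_iff.mp (hd t ht)] at hl
  obtain ⟨k, rfl⟩ := List.length_eq_one_iff.mp (Nat.add_left_cancel hl).symm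
  refine ⟨k, hω k (by simp), ?_⟩
  rw [← inv_inv ρ, e]
  simp

end Parabolic

end CoxeterSystem

namespace LabelledGraph

section Walk

variable {G α : Type*}

theorem altProdRev_add_of_periodic [Monoid G] {F : ℕ → G} (hF : ∀ i, F (i + 2) = F i)
    (i p q : ℕ) : altProdRev (F i) (F (i + 1)) (p + q) =
      altProdRev (F (i + q)) (F (i + q + 1)) p * altProdRev (F i) (F (i + 1)) q := by
  induction q generalizing i with
  | zero => simp [altProdRev]
  | succ q ih =>
    have h := ih (i + 1)
    rw [add_assoc i 1 1, hF] at h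
    rw [← add_assoc, altProdRev, h, altProdRev, mul_assoc, add_assoc i 1 q, add_comm 1 q]

/-- Two alternating words acting on a line of points with a loop at either end
have the same effect. -/
theorem altProdRev_apply_of_line {F : ℕ → Equiv.Perm α} (hF : ∀ i, F (i + 2) = F i) {N : ℕ}
    {P P' : ℕ → α} (hu : ∀ k < N, F k (P k) = P (k + 1))
    (hd : ∀ k < N, F k (P' (k + 1)) = P' k) (hd₀ : ∀ k < N, F k (P (k + 1)) = P k)
    (hu' : ∀ k < N, F k (P' k) = P' (k + 1))
    (h0 : F 1 (P 0) = P' 0) (hN : F N (P N) = P' N) {k : ℕ} (hk : k ≤ N) :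
    altProdRev (F k) (F (k + 1)) (N + 1) (P k) = altProdRev (F (k + 1)) (F k) (N + 1) (P k) := by
  have up : ∀ (Q : ℕ → α), (∀ k < N, F k (Q k) = Q (k + 1)) → ∀ j k, k + j ≤ N →
      altProdRev (F k) (F (k + 1)) j (Q k) = Q (k + j) := by
    intro Q hQ j
    induction j with
    | zero => intro k _; simp [altProdRev]
    | succ j ih =>
      intro k h
      have := ih (k + 1) (by omega)
      rw [altProdRev, Equiv.Perm.mul_apply, hQ k (by omega), ← hF k, this]
      congr 1
      omega
  have down : ∀ (Q : ℕ → α), (∀ k < N, F k (Q (k + 1)) = Q k) → ∀ j k, j ≤ k → k ≤ N →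
      altProdRev (F (k + 1)) (F k) j (Q k) = Q (k - j) := by
    intro Q hQ j
    induction j with
    | zero => intro k _ _; simp [altProdRev]
    | succ j ih =>
      intro k h h'
      obtain ⟨k, rfl⟩ : ∃ k', k = k' + 1 := ⟨k - 1, by omega⟩
      rw [altProdRev, Equiv.Perm.mul_apply, hF, hQ k (by omega), ih k (by omega) (by omega)]
      congr 1
      omega
  have hF2 : ∀ i k, F (2 * i + k) = F k := by
    intro i k
    induction i with
    | zero => simp
    | succ i ih => rw [← ih, ← hF (2 * i + k)]; congr 1; omega
  trans P' (N - k)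
  · have e := altProdRev_add_of_periodic hF k (k + 1) (N - k)
    rw [show k + 1 + (N - k) = N + 1 by omega, show k + (N - k) = N by omega] at e
    rw [e, Equiv.Perm.mul_apply, up P hu _ _ (by omega), show k + (N - k) = N by omega, altProdRev,
      Equiv.Perm.mul_apply, hN, down P' hd _ _ hk le_rfl]
  · have e := altProdRev_add_of_periodic hF (k + 1) (N - k + 1) k
    rw [show N - k + 1 + k = N + 1 by omega, show k + 1 + k = 2 * k + 1 by omega,
      show k + 1 + 1 = 2 * 1 + k by omega, show 2 * k + 1 + 1 = 2 * (k + 1) + 0 by omega,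
      hF2, hF2, hF2] at e
    rw [e, Equiv.Perm.mul_apply, down P hd₀ _ _ le_rfl hk, Nat.sub_self, altProdRev,
      Equiv.Perm.mul_apply, h0]
    simpa using (up P' hu' (N - k) 0 (by omega)).symm

end Walk

end LabelledGraph

namespace CoxeterSystem

open LabelledGraph

variable {B W : Type*} [Group W] {M : CoxeterMatrix B} (cs : CoxeterSystem M W)

section Action

variable {G : Type*} [Group G] (X : Set B) (τ : B → G)

open Classical in
/-- The action of a simple reflection on the minimal coset representatives. -/
noncomputable def stepRep (i : B) : Equiv.Perm (cs.minReps X) :=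
  Function.Involutive.toPerm
    (fun w => if h : cs.simple i * w ∈ cs.minReps X then ⟨cs.simple i * w, h⟩ else w) (by
      intro w
      by_cases h : cs.simple i * w ∈ cs.minReps X
      · simp [h]
      · simp [h])

open Classical in
/-- The factor contributed by a simple reflection fixing a coset. -/
noncomputable def loopFactor (i : B) (w : W) : G :=
  if h : ∃ t ∈ X, cs.simple i * w = w * cs.simple t then τ h.choose else 1

/-- The action of a simple reflection on the product of the minimal coset representatives
with a group receiving the generators of the parabolic subgroup. -/
noncomputable def act (i : B) : Equiv.Perm (cs.minReps X × G) :=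
  Equiv.prodShear (cs.stepRep X i) fun w => Equiv.mulLeft (cs.loopFactor X τ i w)

variable {cs X τ}

open Classical in
theorem stepRep_apply (i : B) (w : cs.minReps X) : cs.stepRep X i w =
    if h : cs.simple i * w ∈ cs.minReps X then ⟨cs.simple i * w, h⟩ else w := rfl

theorem act_of_mem {i : B} {w : cs.minReps X} (h : cs.simple i * w ∈ cs.minReps X) (g : G) :
    cs.act X τ i (w, g) = (⟨cs.simple i * w, h⟩, g) := by
  have h1 : ¬ ∃ t ∈ X, cs.simple i * w = w * cs.simple t := by
    rintro ⟨t, ht, e⟩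
    exact mul_simple_notMem_minReps w.2 ht (e ▸ h)
  simp [act, stepRep_apply, loopFactor, h, h1]

theorem act_of_eq {i t : B} {w : cs.minReps X} (ht : t ∈ X)
    (h : cs.simple i * w = w * cs.simple t) (g : G) :
    cs.act X τ i (w, g) = (w, τ t * g) := by
  have h1 : ∃ t ∈ X, cs.simple i * w = w * cs.simple t := ⟨t, ht, h⟩
  have h2 : cs.simple i * w ∉ cs.minReps X := h ▸ mul_simple_notMem_minReps w.2 ht
  have h3 : h1.choose = t := cs.simple_injective (mul_left_cancel (h1.choose_spec.2.symm.trans h))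
  simp only [act, stepRep_apply, loopFactor, Equiv.prodShear_apply, Equiv.coe_mulLeft, dif_pos h1,
    h3]
  simp [h2]

theorem mem_of_step_closed {D : Set B} {d : W} {S : Set W} (hdS : d ∈ S)
    (hS : S ⊆ cs.minReps X)
    (hstep : ∀ v ∈ S, ∀ i ∈ D, cs.simple i * v ∈ cs.minReps X → cs.simple i * v ∈ S)
    {y x : W} (hy : y ∈ cs.parabolic D) (hx : x ∈ cs.parabolic X)
    (h : y * d * x ∈ cs.minReps X) : y * d * x ∈ S := by
  have key : ∃ x ∈ cs.parabolic X, y * d * x ∈ S := by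
    have step : ∀ i ∈ D, ∀ y : W, (∃ x ∈ cs.parabolic X, y * d * x ∈ S) →
        ∃ x ∈ cs.parabolic X, cs.simple i * y * d * x ∈ S := by
      rintro i hi y ⟨x, hx, hxS⟩
      by_cases hR : cs.simple i * (y * d * x) ∈ cs.minReps X
      · refine ⟨x, hx, ?_⟩
        simpa only [mul_assoc] using hstep _ hxS i hi hR
      · obtain ⟨t, ht, e⟩ := exists_simple_mul_eq_mul_simple (hS hxS) hR
        refine ⟨x * cs.simple t, mul_mem hx (simple_mem_parabolic ht), ?_⟩
        have : cs.simple i * y * d * (x * cs.simple t) = y * d * x := by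
          simp only [mul_assoc] at e ⊢
          rw [← e]
          simp
        rwa [this]
    refine Subgroup.closure_induction_left
      (p := fun y _ => ∃ x ∈ cs.parabolic X, y * d * x ∈ S) ?_ ?_ ?_ hy
    · exact ⟨1, one_mem _, by simpa using hdS⟩
    · rintro _ ⟨i, hi, rfl⟩ y _ h
      exact step i hi y h
    · rintro _ ⟨i, hi, rfl⟩ y _ h
      rw [inv_simple]
      exact step i hi y h
  obtain ⟨x', hx', hxS⟩ := key
  have e := eq_of_mem_minReps (hS hxS) (mul_mem (inv_mem hx') hx) (by simpa [mul_assoc] using h)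
  have e' : y * d * x = y * d * x' * (x'⁻¹ * x) := by simp [mul_assoc]
  rw [e', e]
  exact hxS

theorem parabolic_mul_mem_minReps {D : Set B} {d : W} (hd : d ∈ cs.minReps X)
    (hd' : d⁻¹ ∈ cs.minReps D) (h : ∀ i ∈ D, cs.simple i * d ∈ cs.minReps X) {y : W}
    (hy : y ∈ cs.parabolic D) : y * d ∈ cs.minReps X := by
  have step : ∀ i ∈ D, ∀ y ∈ cs.parabolic D, y * d ∈ cs.minReps X →
      cs.simple i * y * d ∈ cs.minReps X := by
    intro i hi y hy hR
    by_contra hn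
    rw [mul_assoc] at hn
    obtain ⟨t, ht, e⟩ := exists_simple_mul_eq_mul_simple hR hn
    have e' : y⁻¹ * cs.simple i * y * d = d * cs.simple t := by
      rw [mul_assoc, mul_assoc, e]
      simp [mul_assoc]
    obtain ⟨k, hk, hρ⟩ := exists_eq_simple_of_mul_eq_mul_simple hd hd'
      (mul_mem (mul_mem (inv_mem hy) (simple_mem_parabolic hi)) hy) ht e'
    rw [hρ] at e'
    exact mul_simple_notMem_minReps hd ht (e' ▸ h k hk)
  refine Subgroup.closure_induction_left (p := fun y _ => y * d ∈ cs.minReps X) ?_ ?_ ?_ hy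
  · simpa using hd
  · rintro _ ⟨i, hi, rfl⟩ y hy h
    exact step i hi y hy h
  · rintro _ ⟨i, hi, rfl⟩ y hy h
    rw [inv_simple]
    exact step i hi y hy h

theorem altProdRev_act_apply_of_forall_mem {i j : B} {w : cs.minReps X}
    (h : ∀ y ∈ cs.parabolic {i, j}, y * w ∈ cs.minReps X) (n : ℕ) (g : G) :
    ∃ h', altProdRev (cs.act X τ i) (cs.act X τ j) n (w, g) =
      (⟨altProdRev (cs.simple i) (cs.simple j) n * w, h'⟩, g) := by
  induction n generalizing i j w with
  | zero => exact ⟨by simp [altProdRev], by simp [altProdRev]⟩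
  | succ n ih =>
    have hi : cs.simple i * (w : W) ∈ cs.minReps X := h _ (simple_mem_parabolic (by simp))
    obtain ⟨h', e⟩ := ih (i := j) (j := i) (w := ⟨_, hi⟩) (by
      intro y hy
      rw [← mul_assoc]
      rw [Set.pair_comm] at hy
      exact h _ (mul_mem hy (simple_mem_parabolic (by simp))))
    refine ⟨by simpa [altProdRev, mul_assoc] using h', ?_⟩
    simp only [altProdRev, Equiv.Perm.mul_apply, act_of_mem hi, e, mul_assoc]

theorem altProdRev_act_apply_of_eq {i j t t' : B} {w : cs.minReps X} (ht : t ∈ X) (ht' : t' ∈ X)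
    (h : cs.simple i * w = w * cs.simple t) (h' : cs.simple j * w = w * cs.simple t')
    (n : ℕ) (g : G) : altProdRev (cs.act X τ i) (cs.act X τ j) n (w, g) =
      (w, altProdRev (τ t) (τ t') n * g) := by
  induction n generalizing i j t t' g with
  | zero => simp [altProdRev]
  | succ n ih =>
    rw [altProdRev, Equiv.Perm.mul_apply, act_of_eq ht h, ih ht' ht h' h, altProdRev, mul_assoc]

theorem altProdRev_act_apply_of_line {a b t : B} (hab : a ≠ b) (h0 : M a b ≠ 0) {d : W}
    (hd : d ∈ cs.minReps X) (hd' : d⁻¹ ∈ cs.minReps {a, b}) (ht : t ∈ X)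
    (ha : cs.simple a * d = d * cs.simple t) (hb : cs.simple b * d ∈ cs.minReps X)
    {y x : W} (hy : y ∈ cs.parabolic {a, b}) (hx : x ∈ cs.parabolic X)
    (hw : y * d * x ∈ cs.minReps X) (g : G) :
    altProdRev (cs.act X τ a) (cs.act X τ b) (M a b) (⟨y * d * x, hw⟩, g) =
      altProdRev (cs.act X τ b) (cs.act X τ a) (M a b) (⟨y * d * x, hw⟩, g) := by
  classical
  obtain ⟨N, hN⟩ := Nat.exists_eq_succ_of_ne_zero h0
  let c : ℕ → B := fun k => if Even k then b else a
  let z : ℕ → W := fun k => altProdRev (cs.simple b) (cs.simple a) k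
  have hc2 : ∀ k, c (k + 2) = c k := fun k => by simp [c, Nat.even_add]
  have hcc : ∀ k, ∀ i ∈ ({a, b} : Set B), i = c k ∨ i = c (k + 1) := by
    rintro k i (rfl | rfl) <;> by_cases h : Even k <;> simp [c, Nat.even_add_one, h]
  have hcm : ∀ k, c k ∈ ({a, b} : Set B) := fun k => by
    by_cases h : Even k <;> simp [c, h]
  have hz : ∀ k, z (k + 1) = cs.simple (c k) * z k := fun k => by
    simp only [z, c]
    rw [altProdRev_succ_left]
    split_ifs <;> rfl
  have hz' : ∀ k, cs.simple (c k) * z (k + 1) = z k := fun k => by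
    rw [hz, simple_mul_simple_cancel_left]
  have hzm : ∀ k, z k ∈ cs.parabolic {a, b} := by
    intro k
    induction k with
    | zero => exact one_mem _
    | succ k ih =>
      rw [hz]
      exact mul_mem (simple_mem_parabolic (hcm k)) ih
  have hcomm : ∀ k, z k = altProdRev (cs.simple a) (cs.simple b) k ↔ M a b ∣ k := by
    intro k
    rw [altProdRev_comm_iff, altProd_comm_iff_pow_eq_one (cs.simple_mul_simple_self b)
      (cs.simple_mul_simple_self a), simple_mul_simple_pow_eq_one_iff, M.symmetric]
  have hR : ∀ k ≤ N, z k * d ∈ cs.minReps X := by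
    intro k
    induction k with
    | zero => intro _; simpa [z, altProdRev] using hd
    | succ k ih =>
      intro hk
      by_contra hn
      rw [hz, mul_assoc] at hn
      obtain ⟨t', ht', e⟩ := exists_simple_mul_eq_mul_simple (ih (by omega)) hn
      have e' : (z k)⁻¹ * cs.simple (c k) * z k * d = d * cs.simple t' := by
        rw [mul_assoc, mul_assoc, e]
        simp [mul_assoc]
      obtain ⟨i, hi, hρ⟩ := exists_eq_simple_of_mul_eq_mul_simple hd hd'
        (mul_mem (mul_mem (inv_mem (hzm k)) (simple_mem_parabolic (hcm k))) (hzm k)) ht' e'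
      rw [hρ] at e'
      obtain rfl | rfl := hi
      · rw [mul_assoc, inv_mul_eq_iff_eq_mul, ← hz] at hρ
        have := Nat.le_of_dvd (by omega) ((hcomm (k + 1)).mp hρ)
        omega
      · exact mul_simple_notMem_minReps hd ht' (e' ▸ hb)
  have hend : cs.simple (c N) * (z N * d) = z N * d * cs.simple t := by
    rw [← mul_assoc, ← hz, (hcomm (N + 1)).mpr (by rw [hN]), altProdRev, mul_assoc, ha, mul_assoc]
  obtain ⟨k, hk, e⟩ : y * d * x ∈ {v | ∃ k ≤ N, v = z k * d} := by
    refine mem_of_step_closed (D := {a, b}) ?_ ?_ ?_ hy hx hw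
    · exact ⟨0, by omega, by simp [z, altProdRev]⟩
    · rintro _ ⟨k, hk, rfl⟩
      exact hR k hk
    · rintro _ ⟨k, hk, rfl⟩ i hi hiR
      obtain rfl | rfl := hcc k i hi
      · obtain rfl | hk' := hk.eq_or_lt
        · exact absurd (hend ▸ hiR) (mul_simple_notMem_minReps (hR _ le_rfl) ht)
        · exact ⟨k + 1, hk', by rw [hz, mul_assoc]⟩
      · cases k with
        | zero =>
          have : cs.simple (c (0 + 1)) * (z 0 * d) = d * cs.simple t := by
            simpa [z, c, altProdRev] using ha
          exact absurd (this ▸ hiR) (mul_simple_notMem_minReps hd ht)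
        | succ k => exact ⟨k, by omega, by rw [hc2, ← mul_assoc, hz']⟩
  let P : G → ℕ → cs.minReps X × G := fun g k =>
    (if h : z k * d ∈ cs.minReps X then ⟨z k * d, h⟩ else ⟨1, one_mem_minReps⟩, g)
  have hP : ∀ g k, ∀ h : k ≤ N, P g k = (⟨z k * d, hR k h⟩, g) := fun g k h => by
    simp [P, hR k h]
  have hu : ∀ g, ∀ k < N, cs.act X τ (c k) (P g k) = P g (k + 1) := by
    intro g k hk
    have h1 := hR (k + 1) hk
    rw [hz, mul_assoc] at h1
    rw [hP g k hk.le, hP g (k + 1) hk, act_of_mem h1]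
    simp [hz, mul_assoc]
  have hdn : ∀ g, ∀ k < N, cs.act X τ (c k) (P g (k + 1)) = P g k := by
    intro g k hk
    have h1 := hR k hk.le
    rw [← hz', mul_assoc] at h1
    rw [hP g k hk.le, hP g (k + 1) hk, act_of_mem h1]
    simp [← hz' k, mul_assoc]
  have h00 : cs.act X τ (c 1) (P g 0) = P (τ t * g) 0 := by
    rw [hP _ 0 (Nat.zero_le _), hP _ 0 (Nat.zero_le _), act_of_eq ht]
    simpa [z, c, altProdRev] using ha
  have hNN : cs.act X τ (c N) (P g N) = P (τ t * g) N := by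
    rw [hP _ N le_rfl, hP _ N le_rfl, act_of_eq ht hend]
  have key := altProdRev_apply_of_line (F := fun k => cs.act X τ (c k))
    (fun k => by simp only [hc2]) (hu g) (hdn (τ t * g)) (hdn g) (hu (τ t * g)) h00 hNN hk
  rw [hP g k hk] at key
  simp only [e, hN, Nat.succ_eq_add_one]
  by_cases hev : Even k
  · simpa [c, hev, Nat.even_add_one] using key.symm
  · simpa [c, hev, Nat.even_add_one] using key

/-- The permutations `act i` satisfy the braid relations. -/
theorem altProdRev_act (hτ : ∀ t ∈ X, ∀ t' ∈ X, t ≠ t' → M t t' ≠ 0 →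
      altProdRev (τ t) (τ t') (M t t') = altProdRev (τ t') (τ t) (M t t'))
    {i j : B} (hij : i ≠ j) (h0 : M i j ≠ 0) :
    altProdRev (cs.act X τ i) (cs.act X τ j) (M i j) =
      altProdRev (cs.act X τ j) (cs.act X τ i) (M i j) := by
  ext1 ⟨⟨w, hw⟩, g⟩
  obtain ⟨y, hy, x, hx, hmin⟩ := exists_length_minimal (cs := cs) w {i, j} X
  obtain ⟨d, hd⟩ : ∃ d, d = y * w * x := ⟨_, rfl⟩
  rw [← hd] at hmin
  obtain rfl : w = y⁻¹ * d * x⁻¹ := by simp [hd, mul_assoc]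
  replace hy := inv_mem hy
  replace hx := inv_mem hx
  have hdX : d ∈ cs.minReps X := fun t ht h =>
    absurd (hmin 1 (one_mem _) _ (simple_mem_parabolic ht)) (by simpa [IsRightDescent] using h)
  have hdD : d⁻¹ ∈ cs.minReps {i, j} := fun t ht h => by
    rw [isRightDescent_inv_iff] at h
    exact absurd (hmin _ (simple_mem_parabolic ht) 1 (one_mem _))
      (by simpa [IsLeftDescent] using h)
  by_cases hi : cs.simple i * d ∈ cs.minReps X <;> by_cases hj : cs.simple j * d ∈ cs.minReps X
  · have hall : ∀ y ∈ cs.parabolic {i, j}, y * d ∈ cs.minReps X := fun y hy =>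
      parabolic_mul_mem_minReps hdX hdD (by rintro k (rfl | rfl) <;> assumption) hy
    have e := eq_of_mem_minReps (hall _ hy) hx hw
    have hall' : ∀ z ∈ cs.parabolic {i, j}, z * (y⁻¹ * d * x⁻¹) ∈ cs.minReps X := fun z hz => by
      rw [e, ← mul_assoc]
      exact hall _ (mul_mem hz hy)
    obtain ⟨h1, e1⟩ := altProdRev_act_apply_of_forall_mem (τ := τ) (w := ⟨_, hw⟩) hall' (M i j) g
    rw [Set.pair_comm] at hall'
    obtain ⟨h2, e2⟩ := altProdRev_act_apply_of_forall_mem (τ := τ) (w := ⟨_, hw⟩) hall' (M i j) g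
    rw [e1, e2]
    have : altProdRev (cs.simple i) (cs.simple j) (M i j) =
        altProdRev (cs.simple j) (cs.simple i) (M i j) := by
      rw [altProdRev_comm_iff, altProd_comm_iff_pow_eq_one (cs.simple_mul_simple_self i)
        (cs.simple_mul_simple_self j), simple_mul_simple_pow]
    simp only [this]
  · obtain ⟨t, ht, e⟩ := exists_simple_mul_eq_mul_simple hdX hj
    rw [Set.pair_comm] at hdD hy
    rw [M.symmetric] at h0 ⊢
    exact (altProdRev_act_apply_of_line hij.symm h0 hdX hdD ht e hi hy hx hw g).symm
  · obtain ⟨t, ht, e⟩ := exists_simple_mul_eq_mul_simple hdX hi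
    exact altProdRev_act_apply_of_line hij h0 hdX hdD ht e hj hy hx hw g
  · obtain ⟨t, ht, e⟩ := exists_simple_mul_eq_mul_simple hdX hi
    obtain ⟨t', ht', e'⟩ := exists_simple_mul_eq_mul_simple hdX hj
    have hS : y⁻¹ * d * x⁻¹ ∈ ({d} : Set W) := by
      refine mem_of_step_closed (D := {i, j}) (Set.mem_singleton d)
        (Set.singleton_subset_iff.mpr hdX) ?_ hy hx hw
      rintro v rfl k (rfl | rfl) hk <;> contradiction
    simp only [Set.mem_singleton_iff] at hS
    have htt : t ≠ t' := by
      rintro rfl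
      exact hij (cs.simple_injective (mul_right_cancel (e.trans e'.symm)))
    have hM : M t t' = M i j := by
      have conj : ∀ n, (cs.simple i * cs.simple j) ^ n = 1 ↔
          (cs.simple t * cs.simple t') ^ n = 1 := by
        intro n
        have h1 : cs.simple i * cs.simple j = d * (cs.simple t * cs.simple t') * d⁻¹ := by
          rw [eq_mul_inv_iff_mul_eq, mul_assoc, e', ← mul_assoc, e, mul_assoc]
        rw [h1, conj_pow, conj_eq_one_iff]
      apply Nat.dvd_antisymm
      · rw [← simple_mul_simple_pow_eq_one_iff cs, ← conj, simple_mul_simple_pow]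
      · rw [← simple_mul_simple_pow_eq_one_iff cs, conj, simple_mul_simple_pow]
    rw [altProdRev_act_apply_of_eq ht ht' (by simpa only [hS] using e)
      (by simpa only [hS] using e'),
      altProdRev_act_apply_of_eq ht' ht (by simpa only [hS] using e')
      (by simpa only [hS] using e), ← hM,
      hτ t ht t' ht' htt (by rwa [hM])]

end Action

end CoxeterSystem

namespace CoxeterSystem

variable {B W : Type*} [Group W] {M : CoxeterMatrix B} {cs : CoxeterSystem M W} {X : Set B} {s : B}

theorem simple_mem_minReps (hs : s ∉ X) : cs.simple s ∈ cs.minReps X := by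
  by_contra h
  rw [← mul_one (cs.simple s)] at h
  obtain ⟨t, ht, e⟩ := exists_simple_mul_eq_mul_simple one_mem_minReps h
  rw [mul_one, one_mul] at e
  exact hs (cs.simple_injective e ▸ ht)

/-- If a coset `y s W_X` with `y ∈ W_X` is fixed by a simple reflection of `X`, acting
through `t`, then `s` and `t` commute. -/
theorem matrix_eq_two_of_mul_eq_mul_simple (hs : s ∉ X) {i t : B} (hi : i ∈ X) (ht : t ∈ X)
    {y : W} (hy : y ∈ cs.parabolic X)
    (e : cs.simple i * (y * cs.simple s) = y * cs.simple s * cs.simple t) : M s t = 2 := by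
  have e' : y⁻¹ * cs.simple i * y * cs.simple s = cs.simple s * cs.simple t := by
    rw [mul_assoc, mul_assoc, e]
    simp [mul_assoc]
  obtain ⟨k, hk, hρ⟩ := exists_eq_simple_of_mul_eq_mul_simple (simple_mem_minReps hs)
    (by rw [inv_simple]; exact simple_mem_minReps hs)
    (mul_mem (mul_mem (inv_mem hy) (simple_mem_parabolic hi)) hy) ht e'
  rw [hρ] at e'
  have hst : s ≠ t := fun h => hs (h ▸ ht)
  have h1 : cs.simple s * cs.simple t ≠ 1 := by
    rw [← cs.inv_simple s, Ne, inv_mul_eq_one]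
    exact fun h => hst (cs.simple_injective h)
  have hdesc : cs.IsRightDescent (cs.wordProd [s, t]) s := by
    rw [IsRightDescent, wordProd_cons, wordProd_singleton]
    have h2 := cs.length_mul_mod_two (cs.simple s) (cs.simple t)
    have h3 := mt cs.length_eq_zero_iff.mp h1
    have h4 : cs.length (cs.simple s * cs.simple t * cs.simple s) = 1 := by
      rw [← e', simple_mul_simple_cancel_right, length_simple]
    rw [length_simple, length_simple] at h2
    omega
  obtain ⟨j, hj, e2⟩ := cs.exists_wordProd_eraseIdx hdesc
  rw [wordProd_cons, wordProd_singleton, ← e', simple_mul_simple_cancel_right] at e2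
  have hkt : k = t := by
    match j, hj with
    | 0, _ => exact cs.simple_injective (by simpa using e2)
    | 1, _ =>
      have h : k = s := cs.simple_injective (by simpa using e2)
      exact absurd (h ▸ hk) hs
  subst hkt
  have h2 : M s k ∣ 2 := by
    rw [← cs.simple_mul_simple_pow_eq_one_iff, pow_two]
    nth_rewrite 2 [← e']
    simp [mul_assoc]
  exact ((Nat.dvd_prime Nat.prime_two).mp h2).resolve_left (M.off_diagonal s k hst)

/-- The double coset of `s` modulo `W_X`, paired with a subgroup containing the images of the
generators commuting with `s`, is invariant under the action of the generators in `X`. -/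
theorem act_mem_doubleCoset {G : Type*} [Group G] {τ : B → G} {H : Subgroup G} (hs : s ∉ X)
    (hH : ∀ t ∈ X, M s t = 2 → τ t ∈ H) {i : B} (hi : i ∈ X) {p : cs.minReps X × G}
    (hp : ∃ y ∈ cs.parabolic X, (p.1 : W) = y * cs.simple s ∧ p.2 ∈ H) :
    (∃ y ∈ cs.parabolic X, ((cs.act X τ i p).1 : W) = y * cs.simple s ∧
      (cs.act X τ i p).2 ∈ H) ∧
    (∃ y ∈ cs.parabolic X, (((cs.act X τ i)⁻¹ p).1 : W) = y * cs.simple s ∧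
      ((cs.act X τ i)⁻¹ p).2 ∈ H) := by
  obtain ⟨⟨w, hw⟩, g⟩ := p
  obtain ⟨y, hy, rfl : w = _, hg : g ∈ H⟩ := hp
  by_cases hR : cs.simple i * (y * cs.simple s) ∈ cs.minReps X
  · have h2 : cs.simple i * (cs.simple i * (y * cs.simple s)) ∈ cs.minReps X := by
      simpa using hw
    have hmem : cs.simple i * y ∈ cs.parabolic X := mul_mem (simple_mem_parabolic hi) hy
    have hinv : (cs.act X τ i)⁻¹ (⟨_, hw⟩, g) = (⟨_, hR⟩, g) := by
      rw [Equiv.Perm.inv_eq_iff_eq, act_of_mem h2]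
      simp
    rw [act_of_mem hR, hinv]
    exact ⟨⟨_, hmem, (mul_assoc _ _ _).symm, hg⟩, ⟨_, hmem, (mul_assoc _ _ _).symm, hg⟩⟩
  · obtain ⟨t, ht, e⟩ := exists_simple_mul_eq_mul_simple hw hR
    have hτ := hH t ht (matrix_eq_two_of_mul_eq_mul_simple hs hi ht hy e)
    have hinv : (cs.act X τ i)⁻¹ (⟨_, hw⟩, g) = (⟨_, hw⟩, (τ t)⁻¹ * g) := by
      rw [Equiv.Perm.inv_eq_iff_eq, act_of_eq ht e, mul_inv_cancel_left]
    rw [act_of_eq ht e, hinv]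
    exact ⟨⟨y, hy, rfl, mul_mem hτ hg⟩, ⟨y, hy, rfl, mul_mem (inv_mem hτ) hg⟩⟩

end CoxeterSystem

namespace LabelledGraph

open CoxeterSystem

variable {V : Type*} (Γ : LabelledGraph V)

section Lift

variable {G : Type*} [Group G]

theorem altProd_σ {u v : V} (huv : u ≠ v) {k : ℕ} (hk : Γ.m u v = k) :
    altProd (Γ.σ u) (Γ.σ v) k = altProd (Γ.σ v) (Γ.σ u) k := by
  have h : PresentedGroup.mk Γ.artinRels (altWord u v k * (altWord v u k)⁻¹) = 1 :=
    PresentedGroup.one_of_mem ⟨u, v, k, huv, hk, rfl⟩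
  rw [map_mul, map_inv, mul_inv_eq_one, altWord, altWord, map_altProd, map_altProd] at h
  exact h

/-- The universal property of the Artin group. -/
def lift (f : V → G) (hf : ∀ u v (k : ℕ), u ≠ v → Γ.m u v = k →
    altProd (f u) (f v) k = altProd (f v) (f u) k) : Γ.ArtinGroup →* G :=
  PresentedGroup.toGroup (f := f) (by
    rintro r ⟨u, v, k, huv, hk, rfl⟩
    rw [map_mul, map_inv, mul_inv_eq_one, altWord, altWord, map_altProd, map_altProd]
    simpa using hf u v k huv hk)

@[simp]
theorem lift_σ (f : V → G) (hf : ∀ u v (k : ℕ), u ≠ v → Γ.m u v = k →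
    altProd (f u) (f v) k = altProd (f v) (f u) k) (v : V) : Γ.lift f hf (Γ.σ v) = f v :=
  PresentedGroup.toGroup.of _

variable {Γ}

theorem hom_ext {φ ψ : Γ.ArtinGroup →* G} (h : ∀ v, φ (Γ.σ v) = ψ (Γ.σ v)) : φ = ψ :=
  PresentedGroup.ext h

theorem closure_range_σ : Subgroup.closure (Set.range Γ.σ) = ⊤ :=
  PresentedGroup.closure_range_of _

@[simp]
theorem inclHom_σ (X : Set V) (v : X) : Γ.inclHom X ((Γ.induce X).σ v) = Γ.σ v :=
  mapHom_σ _ _ _ _ _ _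

theorem range_inclHom (X : Set V) : (Γ.inclHom X).range = Γ.specialSubgroup X := by
  rw [MonoidHom.range_eq_map, ← closure_range_σ, MonoidHom.map_closure, specialSubgroup]
  congr 1
  ext a
  constructor
  · rintro ⟨_, ⟨v, rfl⟩, rfl⟩
    exact ⟨v, v.2, (inclHom_σ X v).symm⟩
  · rintro ⟨v, hv, rfl⟩
    exact ⟨_, ⟨⟨v, hv⟩, rfl⟩, inclHom_σ X _⟩

end Lift

section CoxeterMatrix

open Classical in
/-- The Coxeter matrix of a labelled graph, with `0` in place of `∞`. -/
noncomputable def coxeterMatrix : CoxeterMatrix V where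
  M := Matrix.of fun u v => if u = v then 1 else (Γ.m u v).toNat
  isSymm := by
    refine Matrix.IsSymm.ext fun u v => ?_
    rw [Matrix.of_apply, Matrix.of_apply, eq_comm (a := v), Γ.symm v u]
  diagonal u := by simp
  off_diagonal u v huv := by
    have h := Γ.two_le u v huv
    rw [Matrix.of_apply, if_neg huv]
    intro h1
    rw [ENat.toNat_eq_iff one_ne_zero] at h1
    rw [h1] at h
    exact absurd h (by decide)

variable {Γ}

theorem coxeterMatrix_apply {u v : V} (huv : u ≠ v) :
    Γ.coxeterMatrix u v = (Γ.m u v).toNat := by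
  simp [coxeterMatrix, huv]

theorem coxeterMatrix_eq {u v : V} (huv : u ≠ v) {k : ℕ} (hk : Γ.m u v = k) :
    Γ.coxeterMatrix u v = k := by
  simp [coxeterMatrix_apply huv, hk]

theorem m_eq_coxeterMatrix {u v : V} (huv : u ≠ v) (h : Γ.coxeterMatrix u v ≠ 0) :
    Γ.m u v = Γ.coxeterMatrix u v := by
  rw [coxeterMatrix_apply huv] at h ⊢
  rw [ENat.natCast_toNat]
  rintro e
  simp [e] at h

variable (Γ)

/-- The Coxeter system attached to a labelled graph. -/
noncomputable def coxeterSystem : CoxeterSystem Γ.coxeterMatrix Γ.coxeterMatrix.Group :=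
  Γ.coxeterMatrix.toCoxeterSystem

end CoxeterMatrix

section ActHom

variable {G : Type*} [Group G] (X : Set V) (ψ : (Γ.induce X).ArtinGroup →* G)

open Classical in
/-- The images of the generators of a special subgroup, extended by `1`. -/
noncomputable def extendGen (v : V) : G := if h : v ∈ X then ψ ((Γ.induce X).σ ⟨v, h⟩) else 1

/-- The action of the Artin group induced from a homomorphism out of the Artin group of an
induced subgraph. -/
noncomputable def actHom :
    Γ.ArtinGroup →* Equiv.Perm (Γ.coxeterSystem.minReps X × G) :=
  Γ.lift (Γ.coxeterSystem.act X (extendGen Γ X ψ)) (by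
    intro u v k huv hk
    have h2 := Γ.two_le u v huv
    rw [hk] at h2
    have h2' : 2 ≤ k := by exact_mod_cast h2
    have hM := coxeterMatrix_eq huv hk
    rw [← hM, ← altProdRev_comm_iff]
    refine altProdRev_act ?_ huv (by omega)
    intro t ht t' ht' htt h0
    rw [altProdRev_comm_iff, extendGen, extendGen, dif_pos ht, dif_pos ht', ← map_altProd,
      ← map_altProd, (Γ.induce X).altProd_σ]
    · simpa using htt
    · exact m_eq_coxeterMatrix htt h0)

variable {Γ X ψ}

theorem actHom_σ (v : V) :
    Γ.actHom X ψ (Γ.σ v) = Γ.coxeterSystem.act X (extendGen Γ X ψ) v :=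
  Γ.lift_σ _ _ v

theorem actHom_inclHom (a : (Γ.induce X).ArtinGroup) (g : G) :
    Γ.actHom X ψ (Γ.inclHom X a) (⟨1, one_mem_minReps⟩, g) =
      (⟨1, one_mem_minReps⟩, ψ a * g) := by
  have ha : a ∈ Subgroup.closure (Set.range (Γ.induce X).σ) := by
    rw [closure_range_σ]
    exact Subgroup.mem_top a
  induction ha using Subgroup.closure_induction generalizing g with
  | mem _ h =>
    obtain ⟨⟨v, hv⟩, rfl⟩ := h
    rw [inclHom_σ, actHom_σ, act_of_eq hv (by simp), extendGen, dif_pos hv]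
  | one => simp
  | mul a b _ _ iha ihb =>
    rw [map_mul, map_mul, Equiv.Perm.mul_apply, ihb, iha, map_mul, mul_assoc]
  | inv a _ ih =>
    rw [map_inv, map_inv, Equiv.Perm.inv_eq_iff_eq, ih, map_inv, mul_inv_cancel_left]

theorem actHom_σ_one {s : V} (hs : s ∉ X) (g : G) :
    Γ.actHom X ψ (Γ.σ s) (⟨1, one_mem_minReps⟩, g) =
      (⟨Γ.coxeterSystem.simple s, CoxeterSystem.simple_mem_minReps hs⟩, g) := by
  rw [actHom_σ, act_of_mem (by simpa using CoxeterSystem.simple_mem_minReps hs)]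
  simp

end ActHom

section SpecialSubgroup

variable {Γ} {X : Set V}

/-- Special subgroups are presented as expected. -/
theorem inclHom_injective (X : Set V) : Function.Injective (Γ.inclHom X) := by
  rw [injective_iff_map_eq_one]
  intro a ha
  have h := actHom_inclHom (ψ := MonoidHom.id _) a 1
  rw [ha, map_one, Equiv.Perm.one_apply] at h
  simpa using (congrArg Prod.snd h).symm

theorem σ_notMem_specialSubgroup {s : V} (hs : s ∉ X) : Γ.σ s ∉ Γ.specialSubgroup X := by
  rw [← range_inclHom]
  rintro ⟨a, ha⟩
  have h := actHom_inclHom (ψ := MonoidHom.id _) a 1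
  rw [ha, actHom_σ_one hs] at h
  have h' : Γ.coxeterSystem.simple s = 1 := congrArg (fun p => (p.1 : Γ.coxeterMatrix.Group)) h
  have := Γ.coxeterSystem.length_simple s
  simp [h'] at this

theorem mem_specialSubgroup_of_mem_center {z : Γ.ArtinGroup} (hz : z ∈ Subgroup.center _)
    (hzX : z ∈ Γ.specialSubgroup X) {s : V} (hs : s ∉ X) :
    z ∈ Γ.specialSubgroup (X ∩ {t | Γ.m s t = 2}) := by
  have hH : ∀ t ∈ X, Γ.coxeterMatrix s t = 2 →
      Γ.extendGen X (Γ.inclHom X) t ∈ Γ.specialSubgroup (X ∩ {t | Γ.m s t = 2}) := by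
    intro t ht h
    have hst : s ≠ t := fun h => hs (h ▸ ht)
    rw [extendGen, dif_pos ht, inclHom_σ]
    refine Subgroup.subset_closure ⟨t, ⟨ht, ?_⟩, rfl⟩
    have := m_eq_coxeterMatrix hst (h.trans_ne two_ne_zero)
    rw [h] at this
    exact this
  have hT : ∀ a ∈ Γ.specialSubgroup X, ∀ p,
      (∃ y ∈ Γ.coxeterSystem.parabolic X,
        (p.1 : Γ.coxeterMatrix.Group) = y * Γ.coxeterSystem.simple s ∧
        p.2 ∈ Γ.specialSubgroup (X ∩ {t | Γ.m s t = 2})) →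
      (∃ y ∈ Γ.coxeterSystem.parabolic X,
        ((Γ.actHom X (Γ.inclHom X) a p).1 : Γ.coxeterMatrix.Group) =
          y * Γ.coxeterSystem.simple s ∧
        (Γ.actHom X (Γ.inclHom X) a p).2 ∈ Γ.specialSubgroup (X ∩ {t | Γ.m s t = 2})) ∧
      (∃ y ∈ Γ.coxeterSystem.parabolic X,
        (((Γ.actHom X (Γ.inclHom X) a)⁻¹ p).1 : Γ.coxeterMatrix.Group) =
          y * Γ.coxeterSystem.simple s ∧
        ((Γ.actHom X (Γ.inclHom X) a)⁻¹ p).2 ∈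
          Γ.specialSubgroup (X ∩ {t | Γ.m s t = 2})) := by
    intro a ha
    induction ha using Subgroup.closure_induction with
    | mem _ h =>
      obtain ⟨i, hi, rfl⟩ := h
      intro p hp
      rw [actHom_σ]
      exact act_mem_doubleCoset hs hH hi hp
    | one => intro p hp; simpa using hp
    | mul a b _ _ iha ihb =>
      intro p hp
      rw [map_mul, mul_inv_rev]
      exact ⟨(iha _ (ihb p hp).1).1, (ihb _ (iha p hp).2).2⟩
    | inv a _ ih =>
      intro p hp
      rw [map_inv, inv_inv]
      exact (ih p hp).symm
  have h2 := (hT z hzX (⟨Γ.coxeterSystem.simple s, CoxeterSystem.simple_mem_minReps hs⟩, 1)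
    ⟨1, one_mem _, (one_mul _).symm, one_mem _⟩).1
  have h3 : Γ.actHom X (Γ.inclHom X) z
        (⟨Γ.coxeterSystem.simple s, CoxeterSystem.simple_mem_minReps hs⟩, 1) =
      (⟨Γ.coxeterSystem.simple s, CoxeterSystem.simple_mem_minReps hs⟩, z) := by
    rw [← actHom_σ_one (ψ := Γ.inclHom X) hs, ← Equiv.Perm.mul_apply, ← map_mul,
      ← Subgroup.mem_center_iff.mp hz, map_mul, Equiv.Perm.mul_apply]
    rw [← range_inclHom] at hzX
    obtain ⟨a, rfl⟩ := hzX
    rw [actHom_inclHom, mul_one, actHom_σ_one hs]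
  rw [h3] at h2
  exact h2.choose_spec.2.2

/-- The center of an irreducible Artin group meets every proper special subgroup trivially. -/
theorem eq_one_of_mem_center [Finite V] (hΓ : Γ.Irreducible) {z : Γ.ArtinGroup}
    (hz : z ∈ Subgroup.center _) (hX : X ≠ Set.univ) (hzX : z ∈ Γ.specialSubgroup X) : z = 1 := by
  induction X using WellFoundedLT.induction with
  | ind X ih =>
    obtain rfl | hne := X.eq_empty_or_nonempty
    · simpa [specialSubgroup] using hzX
    have h : ∃ s ∉ X, ∃ t ∈ X, Γ.m s t ≠ 2 := by
      by_contra! h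
      refine hΓ ⟨Xᶜ, X, Set.nonempty_compl.mpr hX, hne, disjoint_compl_left,
        Set.compl_union_self X, h⟩
    obtain ⟨s, hs, t, ht, hst⟩ := h
    refine ih (X ∩ {t | Γ.m s t = 2}) ?_ ?_ (mem_specialSubgroup_of_mem_center hz hzX hs)
    · exact Set.inter_subset_left.ssubset_of_mem_notMem ht fun h => hst h.2
    · exact fun h => hs ((Set.eq_univ_iff_forall.mp h s).1)

end SpecialSubgroup

end LabelledGraph

namespace Monoid.PushoutI

variable {ι H : Type*} {G : ι → Type*} [∀ i, Group (G i)] [Group H] {φ : ∀ i, H →* G i}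

variable (φ) in
/-- A list of letters is reduced if consecutive letters lie in different factors and no letter
lies in the base group. -/
def IsReducedList (l : List (Σ i, G i)) : Prop :=
  l.IsChain (fun a b => a.1 ≠ b.1) ∧ ∀ g ∈ l, g.2 ∉ (φ g.1).range

variable (φ) in
/-- The product of a list of letters in the amalgamated product. -/
def listProd (l : List (Σ i, G i)) : PushoutI φ := (l.map fun g => of (φ := φ) g.1 g.2).prod

@[simp]
theorem listProd_nil : listProd φ [] = 1 := rfl

@[simp]
theorem listProd_cons (g : Σ i, G i) (l : List (Σ i, G i)) :
    listProd φ (g :: l) = of g.1 g.2 * listProd φ l := by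
  simp [listProd]

@[simp]
theorem listProd_append (l l' : List (Σ i, G i)) :
    listProd φ (l ++ l') = listProd φ l * listProd φ l' := by
  simp [listProd]

theorem IsReducedList.exists_normalWord {l : List (Σ i, G i)} (hl : IsReducedList φ l)
    (d : NormalWord.Transversal φ) (b : H) : ∃ w : NormalWord d,
      w.prod = base φ b * listProd φ l ∧ w.toList.map Sigma.fst = l.map Sigma.fst := by
  let w₀ : CoprodI.Word G := ⟨l, fun g hg h1 => hl.2 g hg (h1 ▸ one_mem _), hl.1⟩
  obtain ⟨w, hw, hw'⟩ := Reduced.exists_normalWord_prod_eq (φ := φ) d (w := w₀) hl.2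
  refine ⟨b • w, ?_, hw'⟩
  rw [NormalWord.prod_base_smul, hw, CoprodI.Word.prod, map_list_prod, List.map_map]
  simp [listProd, w₀, Function.comp_def]

theorem map_fst_eq_of_listProd_eq (hφ : ∀ i, Function.Injective (φ i))
    {l l' : List (Σ i, G i)} (hl : IsReducedList φ l) (hl' : IsReducedList φ l') {b b' : H}
    (h : base φ b * listProd φ l = base φ b' * listProd φ l') :
    l.map Sigma.fst = l'.map Sigma.fst := by
  obtain ⟨d⟩ := NormalWord.transversal_nonempty φ hφ
  obtain ⟨w, hw, e⟩ := hl.exists_normalWord d b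
  obtain ⟨w', hw', e'⟩ := hl'.exists_normalWord d b'
  rw [← e, ← e', NormalWord.prod_injective (hw.trans (h.trans hw'.symm))]

theorem exists_isReducedList (hφ : ∀ i, Function.Injective (φ i)) (z : PushoutI φ) :
    ∃ (b : H) (l : List (Σ i, G i)), IsReducedList φ l ∧ z = base φ b * listProd φ l := by
  classical
  obtain ⟨d⟩ := NormalWord.transversal_nonempty φ hφ
  obtain ⟨w, rfl⟩ := (NormalWord.equiv (d := d)).symm.surjective z
  refine ⟨w.head, w.toList, ⟨w.chain_ne, ?_⟩, ?_⟩
  · rintro ⟨i, g⟩ hg hr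
    have h := (d.compl i).existsUnique g
    have h1 : ((⟨1, one_mem _⟩, ⟨g, w.normalized i g hg⟩) : (φ i).range × d.set i) =
        (⟨g, hr⟩, ⟨1, d.one_mem i⟩) := h.unique (by simp) (by simp)
    exact w.ne_one _ hg (congrArg (fun p => (p.2 : G i)) h1)
  · change w.prod = _
    rw [NormalWord.prod, CoprodI.Word.prod, map_list_prod, List.map_map]
    simp [listProd, Function.comp_def]

/-- The center of a nontrivial amalgamated product is contained in the base group. -/
theorem mem_range_base_of_mem_center [Nontrivial ι] (hφ : ∀ i, Function.Injective (φ i))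
    (hφ' : ∀ i, ¬ Function.Surjective (φ i)) {z : PushoutI φ} (hz : z ∈ Subgroup.center _) :
    z ∈ (base φ).range := by
  obtain ⟨b, l, hl, rfl⟩ := exists_isReducedList hφ z
  obtain rfl | ⟨l₀, c, rfl⟩ := l.eq_nil_or_concat'
  · simp
  exfalso
  obtain ⟨a, l₁, e⟩ := List.exists_cons_of_ne_nil (l := l₀ ++ [c]) (by simp)
  have hcomm : ∀ g : Σ i, G i, base φ b * listProd φ (l₀ ++ [c] ++ [g]) =
      of g.1 (g.2 * φ g.1 b) * listProd φ (l₀ ++ [c]) := by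
    intro g
    rw [map_mul, of_apply_eq_base, listProd_append, ← mul_assoc, mul_assoc (of _ _),
      Subgroup.mem_center_iff.mp hz]
    simp
  have happ : ∀ g : Σ i, G i, g.2 ∉ (φ g.1).range → c.1 ≠ g.1 →
      IsReducedList φ (l₀ ++ [c] ++ [g]) := by
    refine fun g hg hcg => ⟨hl.1.append (List.isChain_singleton _) (by simpa using hcg), ?_⟩
    intro x hx
    obtain hx | hx := List.mem_append.mp hx
    · exact hl.2 x hx
    · rw [List.mem_singleton.mp hx]
      exact hg
  by_cases hac : a.1 = c.1
  · obtain ⟨j, hj⟩ := exists_ne c.1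
    obtain ⟨h, hh⟩ := not_forall.mp (hφ' j)
    have hred : IsReducedList φ (⟨j, h * φ j b⟩ :: (l₀ ++ [c])) := by
      refine ⟨?_, ?_⟩
      · rw [e, List.isChain_cons_cons, ← e]
        exact ⟨by simpa [hac] using hj, hl.1⟩
      · simp only [List.forall_mem_cons]
        refine ⟨fun hr => hh ?_, hl.2⟩
        exact (Subgroup.mul_mem_cancel_right _ (MonoidHom.mem_range.mpr ⟨b, rfl⟩)).mp hr
    have := map_fst_eq_of_listProd_eq hφ (b' := 1) (happ ⟨j, h⟩ hh hj.symm) hred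
      (by rw [hcomm, map_one, one_mul, listProd_cons])
    rw [e] at this
    simp only [List.cons_append, List.map_cons, List.cons.injEq] at this
    exact hj (this.1.symm.trans hac)
  · have hla : IsReducedList φ l₁ := by
      rw [e] at hl
      exact ⟨hl.1.tail, fun g hg => hl.2 g (List.mem_cons_of_mem _ hg)⟩
    have ha : a.2 ∉ (φ a.1).range := hl.2 a (by simp [e])
    have h1 := hcomm a
    rw [e, listProd_cons, ← mul_assoc, ← map_mul, ← e] at h1
    by_cases hr : a.2 * φ a.1 b * a.2 ∈ (φ a.1).range
    · obtain ⟨b', hb'⟩ := hr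
      rw [← hb', of_apply_eq_base] at h1
      have := congrArg List.length
        (map_fst_eq_of_listProd_eq hφ (happ a ha (Ne.symm hac)) hla h1)
      rw [e] at this
      simp at this
      omega
    · have hred : IsReducedList φ (⟨a.1, a.2 * φ a.1 b * a.2⟩ :: l₁) := by
        rw [e] at hl
        refine ⟨?_, ?_⟩
        · cases l₁ with
          | nil => simp
          | cons x l₁ =>
            rw [List.isChain_cons_cons]
            exact List.isChain_cons_cons.mp hl.1
        · simp only [List.forall_mem_cons]
          exact ⟨hr, hla.2⟩
      have := congrArg List.length
        (map_fst_eq_of_listProd_eq hφ (b' := 1) (happ a ha (Ne.symm hac)) hred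
          (by rw [h1, map_one, one_mul, listProd_cons]))
      rw [e] at this
      simp at this

end Monoid.PushoutI

namespace LabelledGraph

open Monoid

variable {V : Type*} {Γ : LabelledGraph V}

theorem induceHom_σ {K' K : Set V} (h : K' ⊆ K) (v : K') :
    Γ.induceHom h ((Γ.induce K').σ v) = (Γ.induce K).σ (Set.inclusion h v) :=
  mapHom_σ _ _ _ _ _ _

theorem inclHom_induceHom {K' K : Set V} (h : K' ⊆ K) (a : (Γ.induce K').ArtinGroup) :
    Γ.inclHom K (Γ.induceHom h a) = Γ.inclHom K' a := by
  have : (Γ.inclHom K).comp (Γ.induceHom h) = Γ.inclHom K' := by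
    refine hom_ext fun v => ?_
    rw [MonoidHom.comp_apply, induceHom_σ, inclHom_σ, inclHom_σ, Set.coe_inclusion]
  exact DFunLike.congr_fun this a

section Amalgam

variable (Γ) {ι : Type*}

theorem induceHom_injective {K' K : Set V} (h : K' ⊆ K) :
    Function.Injective (Γ.induceHom h) := by
  intro a a' e
  apply inclHom_injective K'
  rw [← inclHom_induceHom h, e, inclHom_induceHom]

theorem not_surjective_induceHom {K' K : Set V} (h : K' ⊂ K) :
    ¬ Function.Surjective (Γ.induceHom h.subset) := by
  intro hs
  obtain ⟨v, hv, hv'⟩ := Set.exists_of_ssubset h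
  obtain ⟨a, ha⟩ := hs ((Γ.induce K).σ ⟨v, hv⟩)
  apply σ_notMem_specialSubgroup (Γ := Γ) hv'
  rw [← range_inclHom, ← inclHom_σ K ⟨v, hv⟩, ← ha, inclHom_induceHom]
  exact ⟨a, rfl⟩

/-- If `Γ` is covered by induced subgraphs meeting pairwise in `C`, such that every edge lies in
one of them, then the center of the Artin group lies in the special subgroup of `C`. -/
theorem center_le_specialSubgroup [Nontrivial ι] {X : ι → Set V} {C : Set V}
    (hC : ∀ i, C ⊂ X i) (hX : ∀ i j, i ≠ j → X i ∩ X j ⊆ C)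
    (hcov : ∀ u v, Γ.m u v ≠ ⊤ → ∃ i, u ∈ X i ∧ v ∈ X i) (hcov' : ∀ v, ∃ i, v ∈ X i) :
    Subgroup.center Γ.ArtinGroup ≤ Γ.specialSubgroup C := by
  let φ : ∀ i, (Γ.induce C).ArtinGroup →* (Γ.induce (X i)).ArtinGroup :=
    fun i => Γ.induceHom (hC i).subset
  let gen : V → PushoutI φ := fun v =>
    PushoutI.of (hcov' v).choose ((Γ.induce _).σ ⟨v, (hcov' v).choose_spec⟩)
  have hgen : ∀ i v (h : v ∈ X i), gen v = PushoutI.of i ((Γ.induce _).σ ⟨v, h⟩) := by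
    intro i v h
    by_cases hi : (hcov' v).choose = i
    · subst hi
      rfl
    · have hv : v ∈ C := hX _ _ hi ⟨(hcov' v).choose_spec, h⟩
      have key : ∀ i (h : v ∈ X i), PushoutI.of (φ := φ) i ((Γ.induce _).σ ⟨v, h⟩) =
          PushoutI.base φ ((Γ.induce C).σ ⟨v, hv⟩) := by
        intro i h
        rw [← PushoutI.of_apply_eq_base φ i]
        exact congrArg _ (induceHom_σ (hC i).subset ⟨v, hv⟩).symm
      exact (key _ _).trans (key i h).symm
  let f : Γ.ArtinGroup →* PushoutI φ := Γ.lift gen (by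
    intro u v k huv hk
    obtain ⟨i, hu, hv⟩ := hcov u v (by rw [hk]; exact ENat.natCast_ne_top k)
    rw [hgen i u hu, hgen i v hv, ← map_altProd, ← map_altProd, altProd_σ]
    · simpa using huv
    · exact hk)
  let g : PushoutI φ →* Γ.ArtinGroup := PushoutI.lift (fun i => Γ.inclHom (X i)) (Γ.inclHom C)
    fun i => MonoidHom.ext fun a => inclHom_induceHom _ a
  have hf : ∀ v, f (Γ.σ v) = gen v := Γ.lift_σ _ _
  have hgf : ∀ z, g (f z) = z := by
    refine DFunLike.congr_fun (f := g.comp f) (g := MonoidHom.id _) (hom_ext fun v => ?_)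
    obtain ⟨i, hi⟩ := hcov' v
    rw [MonoidHom.comp_apply, hf, hgen i v hi, PushoutI.lift_of, inclHom_σ]
    rfl
  have hfg : ∀ z, f (g z) = z := by
    refine DFunLike.congr_fun (f := f.comp g) (g := MonoidHom.id _) ?_
    refine PushoutI.hom_ext_nonempty fun i => hom_ext fun v => ?_
    rw [MonoidHom.comp_apply, MonoidHom.comp_apply, PushoutI.lift_of, inclHom_σ, hf,
      hgen i v v.2]
    rfl
  intro z hz
  have hz' : f z ∈ Subgroup.center _ := by
    rw [Subgroup.mem_center_iff] at hz ⊢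
    intro y
    rw [← hfg y, ← map_mul, ← map_mul, hz]
  obtain ⟨a, ha⟩ := PushoutI.mem_range_base_of_mem_center
    (fun i => Γ.induceHom_injective _) (fun i => Γ.not_surjective_induceHom (hC i)) hz'
  rw [← range_inclHom, ← hgf z, ← ha, PushoutI.lift_base]
  exact ⟨a, rfl⟩

end Amalgam

/-- The center of an irreducible Artin group whose graph is not a clique is trivial. -/
theorem center_eq_bot [Finite V] (hΓ : Γ.Irreducible) {u v : V} (huv : u ≠ v)
    (h : Γ.m u v = ⊤) : Subgroup.center Γ.ArtinGroup = ⊥ := by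
  rw [eq_bot_iff]
  intro z hz
  have hz' : z ∈ Γ.specialSubgroup {u, v}ᶜ := by
    refine center_le_specialSubgroup (Γ := Γ) (ι := Bool) (X := fun b => {cond b u v}ᶜ)
      ?_ ?_ ?_ ?_ hz
    · rintro (_ | _)
      · exact Set.ssubset_iff_exists.mpr
          ⟨Set.compl_subset_compl.mpr (by simp), u, by simpa using huv, by simp⟩
      · exact Set.ssubset_iff_exists.mpr
          ⟨Set.compl_subset_compl.mpr (by simp), v, by simpa using huv.symm, by simp⟩
    · rintro (_ | _) (_ | _) hij <;> simp at hij
      · rintro x ⟨h1, h2⟩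
        simp_all
      · rintro x ⟨h1, h2⟩
        simp_all
    · intro x y hxy
      by_contra! hc
      have h1 := hc true
      have h2 := hc false
      have hvu := h
      rw [Γ.symm] at hvu
      simp only [cond_true, cond_false, Set.mem_compl_iff, Set.mem_singleton_iff, not_not] at h1 h2
      clear hc hz
      by_cases hxu : x = u
      · have hy := h2 (by rw [hxu]; exact huv)
        exact hxy (by rw [hxu, hy, h])
      · have hy := h1 hxu
        have hxv : x = v := by
          by_contra hxv
          exact huv (hy.symm.trans (h2 hxv))
        exact hxy (by rw [hxv, hy, hvu])
    · intro x
      by_cases hx : x = u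
      · exact ⟨false, by simpa [hx] using huv⟩
      · exact ⟨true, by simpa using hx⟩
  refine Subgroup.mem_bot.mpr (eq_one_of_mem_center hΓ hz ?_ hz')
  exact fun h => (Set.eq_univ_iff_forall.mp h u) (by simp)

end LabelledGraph

namespace LabelledGraph

variable {V W : Type*} (Γ : LabelledGraph V)

section Coxeter

variable {G : Type*} [Group G]

/-- The universal property of the Coxeter group. -/
def coxeterLift (f : V → G) (hf : ∀ u v (k : ℕ), u ≠ v → Γ.m u v = k →
    altProd (f u) (f v) k = altProd (f v) (f u) k) (hsq : ∀ v, f v * f v = 1) :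
    Γ.CoxeterGroupOf →* G :=
  PresentedGroup.toGroup (f := f) (by
    rintro r (⟨u, v, k, huv, hk, rfl⟩ | ⟨v, rfl⟩)
    · rw [map_mul, map_inv, mul_inv_eq_one, altWord, altWord, map_altProd, map_altProd]
      simpa using hf u v k huv hk
    · simpa using hsq v)

theorem coxeterLift_of (f : V → G) (hf : ∀ u v (k : ℕ), u ≠ v → Γ.m u v = k →
    altProd (f u) (f v) k = altProd (f v) (f u) k) (hsq : ∀ v, f v * f v = 1) (v : V) :
    Γ.coxeterLift f hf hsq (PresentedGroup.of v) = f v :=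
  PresentedGroup.toGroup.of _

variable {Γ}

theorem altProd_of {u v : V} (huv : u ≠ v) {k : ℕ} (hk : Γ.m u v = k) :
    altProd (PresentedGroup.of u : Γ.CoxeterGroupOf) (PresentedGroup.of v) k =
      altProd (PresentedGroup.of v) (PresentedGroup.of u) k := by
  have h : PresentedGroup.mk (Γ.artinRels ∪ squareRels V)
      (altWord u v k * (altWord v u k)⁻¹) = 1 :=
    PresentedGroup.one_of_mem (Or.inl ⟨u, v, k, huv, hk, rfl⟩)
  rw [map_mul, map_inv, mul_inv_eq_one, altWord, altWord, map_altProd, map_altProd] at h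
  exact h

theorem of_mul_of (v : V) :
    (PresentedGroup.of v : Γ.CoxeterGroupOf) * PresentedGroup.of v = 1 := by
  have h : PresentedGroup.mk (Γ.artinRels ∪ squareRels V)
      (FreeGroup.of v * FreeGroup.of v) = 1 :=
    PresentedGroup.one_of_mem (Or.inr ⟨v, rfl⟩)
  rw [map_mul] at h
  exact h

theorem not_spherical {u v : V} (huv : u ≠ v) (h : Γ.m u v = ⊤) : ¬ Γ.Spherical := by
  intro hfin
  have : Finite Γ.CoxeterGroupOf := hfin
  let f := Γ.coxeterLift Γ.coxeterSystem.simple (by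
    intro u v k huv hk
    rw [altProd_comm_iff_pow_eq_one (Γ.coxeterSystem.simple_mul_simple_self u)
      (Γ.coxeterSystem.simple_mul_simple_self v),
      CoxeterSystem.simple_mul_simple_pow_eq_one_iff, coxeterMatrix_eq huv hk])
    Γ.coxeterSystem.simple_mul_simple_self
  obtain ⟨n, hn, e⟩ := (isOfFinOrder_of_finite
    ((PresentedGroup.of u : Γ.CoxeterGroupOf) * PresentedGroup.of v)).exists_pow_eq_one
  have e' := congrArg f e
  rw [map_pow, map_mul, coxeterLift_of, coxeterLift_of, map_one,
    CoxeterSystem.simple_mul_simple_pow_eq_one_iff, coxeterMatrix_apply huv, h,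
    ENat.toNat_top, zero_dvd_iff] at e'
  exact hn.ne' e'

theorem Spherical.of_equiv {Δ : LabelledGraph W} (e : V ≃ W)
    (he : ∀ u v, Γ.m u v = Δ.m (e u) (e v)) (h : Γ.Spherical) : Δ.Spherical := by
  have : Finite Γ.CoxeterGroupOf := h
  let f : Γ.CoxeterGroupOf →* Δ.CoxeterGroupOf :=
    Γ.coxeterLift (fun v => PresentedGroup.of (e v))
      (fun u v k huv hk => altProd_of (e.injective.ne huv) (by rw [← he, hk]))
      (fun v => of_mul_of (e v))
  refine Finite.of_surjective f ?_
  rw [← MonoidHom.range_eq_top, eq_top_iff, ← PresentedGroup.closure_range_of,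
    Subgroup.closure_le]
  rintro _ ⟨w, rfl⟩
  refine ⟨PresentedGroup.of (e.symm w), ?_⟩
  rw [coxeterLift_of, Equiv.apply_symm_apply]

theorem spherical_induce_univ : (Γ.induce Set.univ).Spherical ↔ Γ.Spherical :=
  ⟨Spherical.of_equiv (Equiv.Set.univ V) fun _ _ => rfl,
    Spherical.of_equiv (Equiv.Set.univ V).symm fun _ _ => rfl⟩

theorem Irreducible.induce_univ (h : Γ.Irreducible) : (Γ.induce Set.univ).Irreducible := by
  rintro ⟨V₁, V₂, h₁, h₂, hd, hu, hm⟩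
  refine h ⟨Subtype.val '' V₁, Subtype.val '' V₂, h₁.image _, h₂.image _,
    (Set.disjoint_image_iff Subtype.val_injective).mpr hd, ?_, ?_⟩
  · rw [← Set.image_union, hu, Set.image_univ, Subtype.range_val]
  · rintro _ ⟨u, hu, rfl⟩ _ ⟨v, hv, rfl⟩
    exact hm u hu v hv

end Coxeter

section Center

/-- Reindexing a free abelian group. -/
def multiplicativeArrowCongr {α β : Type*} (e : α ≃ β) :
    Multiplicative (α → ℤ) ≃* Multiplicative (β → ℤ) :=
  AddEquiv.toMultiplicative (LinearEquiv.funCongrLeft ℤ ℤ e.symm).toAddEquiv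

/-- A product of infinite cyclic groups, indexed by the indices satisfying `S`. -/
def piMultiplicativeEquiv {ι : Type*} (S : ι → Prop) :
    (∀ i, Multiplicative (PLift (S i) → ℤ)) ≃* Multiplicative ({i // S i} → ℤ) where
  toFun f := Multiplicative.ofAdd fun k => (f k.1).toAdd ⟨k.2⟩
  invFun g i := Multiplicative.ofAdd fun h => g.toAdd ⟨i, h.down⟩
  left_inv _ := rfl
  right_inv _ := rfl
  map_mul' _ _ := rfl

/-- The center of a product of groups is the product of the centers. -/
def centerPiEquiv {ι : Type*} (G : ι → Type*) [∀ i, Group (G i)] :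
    Subgroup.center (∀ i, G i) ≃* ∀ i, Subgroup.center (G i) where
  toFun z i := ⟨z.1 i, by
    classical
    refine Subgroup.mem_center_iff.mpr fun g => ?_
    simpa using congrFun (Subgroup.mem_center_iff.mp z.2 (Pi.mulSingle i g)) i⟩
  invFun z := ⟨fun i => z i, Subgroup.mem_center_iff.mpr fun g =>
    funext fun i => Subgroup.mem_center_iff.mp (z i).2 (g i)⟩
  left_inv _ := rfl
  right_inv _ := rfl
  map_mul' _ _ := rfl

variable {Γ}

theorem commute_inclHom {X Y : Set V} (hXY : Disjoint X Y)
    (h : ∀ u ∈ X, ∀ v ∈ Y, Γ.m u v = 2)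
    (a : (Γ.induce X).ArtinGroup) (b : (Γ.induce Y).ArtinGroup) :
    Commute (Γ.inclHom X a) (Γ.inclHom Y b) := by
  have hX : ∀ v ∈ Y, Γ.specialSubgroup X ≤ Subgroup.centralizer {Γ.σ v} := by
    intro v hv
    rw [specialSubgroup, Subgroup.closure_le]
    rintro _ ⟨u, hu, rfl⟩
    rw [SetLike.mem_coe, Subgroup.mem_centralizer_singleton_iff]
    have := Γ.altProd_σ (hXY.ne_of_mem hu hv) (k := 2) (h u hu v hv)
    simpa [altProd] using this
  have hle : Γ.specialSubgroup Y ≤ Subgroup.centralizer (Γ.specialSubgroup X) := by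
    rw [specialSubgroup, Subgroup.closure_le]
    rintro _ ⟨v, hv, rfl⟩
    exact Subgroup.mem_centralizer_iff.mpr fun x hx =>
      Subgroup.mem_centralizer_singleton_iff.mp (hX v hv hx)
  refine hle ?_ _ ?_
  · rw [← range_inclHom]
    exact ⟨b, rfl⟩
  · rw [SetLike.mem_coe, ← range_inclHom]
    exact ⟨a, rfl⟩

/-- The Artin group of a `2`-labelled join is the product of the Artin groups of the parts. -/
theorem nonempty_mulEquiv_pi {ι : Type*} [Finite ι] {P : ι → Set V} (hcov : ∀ v, ∃ i, v ∈ P i)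
    (hdisj : ∀ i j, i ≠ j → Disjoint (P i) (P j))
    (hm : ∀ i j, i ≠ j → ∀ u ∈ P i, ∀ v ∈ P j, Γ.m u v = 2) :
    Nonempty (Γ.ArtinGroup ≃* ∀ i, (Γ.induce (P i)).ArtinGroup) := by
  classical
  have := Fintype.ofFinite ι
  choose idx hidx using hcov
  have hgen : ∀ i v (h : v ∈ P i),
      (Pi.mulSingle (idx v) ((Γ.induce _).σ ⟨v, hidx v⟩) :
        ∀ i, (Γ.induce (P i)).ArtinGroup) = Pi.mulSingle i ((Γ.induce _).σ ⟨v, h⟩) := by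
    intro i v h
    obtain rfl : idx v = i := by
      by_contra hi
      exact (hdisj _ _ hi).ne_of_mem (hidx v) h rfl
    rfl
  let f : Γ.ArtinGroup →* ∀ i, (Γ.induce (P i)).ArtinGroup :=
    Γ.lift (fun v => Pi.mulSingle (idx v) ((Γ.induce _).σ ⟨v, hidx v⟩)) (by
      intro u v k huv hk
      by_cases hi : idx u = idx v
      · rw [hgen (idx v) u (hi ▸ hidx u)]
        change altProd (MonoidHom.mulSingle _ _ _) (MonoidHom.mulSingle _ _ _) k =
          altProd (MonoidHom.mulSingle _ _ _) (MonoidHom.mulSingle _ _ _) k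
        rw [← map_altProd, ← map_altProd, altProd_σ]
        · simpa using huv
        · exact hk
      · have h2 := hm _ _ hi u (hidx u) v (hidx v)
        obtain rfl : k = 2 := by
          rw [hk] at h2
          exact_mod_cast h2
        simpa [altProd] using (Pi.mulSingle_commute hi _ _).eq)
  have hcomm : Pairwise fun i j => ∀ (x : (Γ.induce (P i)).ArtinGroup)
      (y : (Γ.induce (P j)).ArtinGroup), Commute (Γ.inclHom (P i) x) (Γ.inclHom (P j) y) :=
    fun i j hij => commute_inclHom (hdisj i j hij) (hm i j hij)
  let g : (∀ i, (Γ.induce (P i)).ArtinGroup) →* Γ.ArtinGroup :=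
    MonoidHom.noncommPiCoprod (fun i => Γ.inclHom (P i)) hcomm
  have hg : ∀ i x, g (Pi.mulSingle i x) = Γ.inclHom (P i) x :=
    fun i x => MonoidHom.noncommPiCoprod_mulSingle (hcomm := hcomm) _ i x
  have hf : ∀ v, f (Γ.σ v) = Pi.mulSingle (idx v) ((Γ.induce _).σ ⟨v, hidx v⟩) := Γ.lift_σ _ _
  refine ⟨MonoidHom.toMulEquiv f g (hom_ext fun v => ?_) (MonoidHom.pi_ext ?_)⟩
  · rw [MonoidHom.comp_apply, hf, hg, inclHom_σ]
    rfl
  · intro i x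
    have key : (f.comp g).comp (MonoidHom.mulSingle (fun i => (Γ.induce (P i)).ArtinGroup) i) =
        MonoidHom.mulSingle (fun i => (Γ.induce (P i)).ArtinGroup) i := by
      refine hom_ext fun v => ?_
      rw [MonoidHom.comp_apply, MonoidHom.comp_apply, MonoidHom.mulSingle_apply, hg, inclHom_σ,
        hf, hgen i v v.2]
    exact DFunLike.congr_fun key x

end Center

/-- The center of an irreducible Artin group, assuming the Center Conjecture for cliques. -/
theorem Irreducible.nonempty_center_mulEquiv {V : Type u} [Finite V] [Nonempty V]
    {Γ : LabelledGraph V} (hΓ : Γ.Irreducible)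
    (h : (∀ u v : V, u ≠ v → Γ.m u v ≠ ⊤) → Γ.SatisfiesCenterConjecture) :
    Nonempty (Subgroup.center Γ.ArtinGroup ≃* Multiplicative (PLift Γ.Spherical → ℤ)) := by
  by_cases hc : ∀ u v : V, u ≠ v → Γ.m u v ≠ ⊤
  · have hP : Γ.IsIrredDecomp 1 fun _ => Set.univ :=
      ⟨fun _ => Set.univ_nonempty, Set.iUnion_const _,
        fun i j hij => absurd (Subsingleton.elim i j) hij,
        fun i j hij => absurd (Subsingleton.elim i j) hij, fun _ => hΓ.induce_univ⟩
    obtain ⟨e⟩ := h hc 1 _ hP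
    refine ⟨e.trans (multiplicativeArrowCongr ((Finite.equivFin _).symm.trans ?_))⟩
    exact
      { toFun := fun x => ⟨spherical_induce_univ.mp x.2⟩
        invFun := fun x => ⟨0, spherical_induce_univ.mpr x.down⟩
        left_inv := fun x => Subsingleton.elim _ _
        right_inv := fun x => rfl }
  · push Not at hc
    obtain ⟨u, v, huv, hm⟩ := hc
    rw [center_eq_bot hΓ huv hm]
    have : IsEmpty (PLift Γ.Spherical) := ⟨fun x => not_spherical huv hm x.down⟩
    have : Unique (Multiplicative (PLift Γ.Spherical → ℤ)) :=
      inferInstanceAs (Unique (PLift Γ.Spherical → ℤ))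
    exact ⟨MulEquiv.ofUnique⟩

end LabelledGraph

/-- If every Artin group whose defining labelled graph is a clique
satisfies the Center Conjecture, then every Artin group satisfies the Center
Conjecture. -/
theorem satisfiesCenterConjecture_of_cliques :
    (∀ (V : Type u) [Finite V] (Γ : LabelledGraph V),
        (∀ u v : V, u ≠ v → Γ.m u v ≠ ⊤) → Γ.SatisfiesCenterConjecture) →
    ∀ (V : Type u) [Finite V] (Γ : LabelledGraph V), Γ.SatisfiesCenterConjecture := by
  rintro h V _ Γ n P ⟨hne, hcov, hdisj, hm, hirr⟩
  obtain ⟨e⟩ := LabelledGraph.nonempty_mulEquiv_pi (Γ := Γ)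
    (fun v => Set.mem_iUnion.mp (hcov ▸ Set.mem_univ v)) hdisj hm
  have hi : ∀ i, Nonempty (Subgroup.center (Γ.induce (P i)).ArtinGroup ≃*
      Multiplicative (PLift (Γ.induce (P i)).Spherical → ℤ)) := fun i =>
    have := (hne i).to_subtype
    (hirr i).nonempty_center_mulEquiv (h _ _)
  let ei := fun i => (hi i).some
  exact ⟨(Subgroup.centerCongr e).trans <| (LabelledGraph.centerPiEquiv _).trans <|
    (MulEquiv.piCongrRight ei).trans <| (LabelledGraph.piMultiplicativeEquiv _).trans <|
    LabelledGraph.multiplicativeArrowCongr (Finite.equivFin _)⟩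
end
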